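/- For every integer n ≥ 3 there exist a continuum K and a point p ∈ K such that K is simple-n-od-like, K is not simple-(n−1)-od-like, every proper nondegenerate subcontinuum of K is an arc, and every proper nondegenerate subcontinuum of K containing p is an arc having p as an endpoint. -/

import Mathlib

/-! ## Simple-n-ods in the plane, likeness, arcs, triods, indecomposability -/

/-- The simple-`n`-od `T_n ⊆ ℂ`: the union of `n` unit segments emanating from `0`. -/
def simpleOdSet (n : ℕ) : Set ℂ :=
  {z | ∃ t : ℝ, ∃ k : ℕ, t ∈ Set.Icc (0:ℝ) 1 ∧ k < n ∧
    z = (t : ℂ) * Complex.exp (2 * Real.pi * Complex.I * (k : ℂ) / (n : ℂ))}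

/-- `X` is `Y`-like: for every `ε > 0` there is a continuous surjection `X → Y`
all of whose point-inverses have diameter `< ε`. -/
def IsLike (X Y : Type*) [MetricSpace X] [MetricSpace Y] : Prop :=
  ∀ ε : ℝ, 0 < ε → ∃ g : X → Y, Continuous g ∧ Function.Surjective g ∧
    ∀ y : Y, Metric.diam (g ⁻¹' {y}) < ε

/-- `A` is an arc: it is homeomorphic to `[0,1]`. -/
def IsArcSet {K : Type*} [TopologicalSpace K] (A : Set K) : Prop :=
  Nonempty (↥A ≃ₜ ↥(Set.Icc (0:ℝ) 1))

/-- Two sets are mutually separated: neither meets the closure of the other. -/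
def MutuallySeparated {K : Type*} [TopologicalSpace K] (A B : Set K) : Prop :=
  A ∩ closure B = ∅ ∧ closure A ∩ B = ∅

/-- The (sub)continuum `C` is a triod: it contains a subcontinuum `M` such that
`C \ M` is the union of three nonempty pairwise mutually separated sets. -/
def IsTriodSet {K : Type*} [TopologicalSpace K] (C : Set K) : Prop :=
  ∃ M A B D : Set K, IsCompact M ∧ IsConnected M ∧ M ⊆ C ∧
    A.Nonempty ∧ B.Nonempty ∧ D.Nonempty ∧ C \ M = A ∪ B ∪ D ∧
    MutuallySeparated A B ∧ MutuallySeparated A D ∧ MutuallySeparated B D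

/-- A space is atriodic if it contains no subcontinuum which is a triod. -/
def AtriodicSpace (K : Type*) [TopologicalSpace K] : Prop :=
  ∀ C : Set K, IsCompact C → IsConnected C → ¬ IsTriodSet C

/-- A space is indecomposable if it is not the union of two proper subcontinua. -/
def IndecomposableSpace (K : Type*) [TopologicalSpace K] : Prop :=
  ¬ ∃ A B : Set K, IsCompact A ∧ IsConnected A ∧ IsCompact B ∧ IsConnected B ∧
    A ≠ Set.univ ∧ B ≠ Set.univ ∧ A ∪ B = Set.univ

namespace StarContinuum

/-- The tent function of height one supported on the unit interval. -/
noncomputable def bump (u : ℝ) : ℝ := max 0 (1 - |2 * u - 1|)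

/-- The height of the tent in position `s` of the word of leg `i`. -/
noncomputable def height (n i s : ℕ) : ℝ := if (s / n) % n = i then 1 else 1 / 2

theorem bump_nonneg (u : ℝ) : 0 ≤ bump u := le_max_left _ _

theorem bump_le_one (u : ℝ) : bump u ≤ 1 := by
  unfold bump
  have := abs_nonneg (2 * u - 1)
  exact max_le (by norm_num) (by linarith)

theorem height_le_one (n i s : ℕ) : height n i s ≤ 1 := by
  unfold height; split_ifs <;> norm_num

theorem half_le_height (n i s : ℕ) : 1 / 2 ≤ height n i s := by
  unfold height; split_ifs <;> norm_num

/-- A discrete model of a pair of maps `X → star`, one with `n` legs (recorded by `θ` and `leg`) and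
one with `m` legs (recorded by `h`), such that the fibres of the second map respect the folding
pattern given by `height` and `bump`. -/
structure Labelling (X : Type*) (n m : ℕ) where
  adj : X → X → Prop
  adj_refl : ∀ x, adj x x
  adj_symm : ∀ x y, adj x y → adj y x
  chain : ∀ x y, Relation.ReflTransGen adj x y
  θ : X → ℝ
  leg : X → ℕ
  h : X → Fin m → ℕ
  bound : ℕ
  θ_nonneg : ∀ x, 0 ≤ θ x
  leg_lt : ∀ x, leg x < n
  θ_step : ∀ x y, adj x y → |θ x - θ y| < 1 / 16
  leg_step : ∀ x y, adj x y → leg x ≠ leg y → θ x < 1 / 16 ∧ θ y < 1 / 16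
  h_support : ∀ x i j, h x i ≠ 0 → h x j ≠ 0 → i = j
  h_step : ∀ x y i, adj x y → h x i ≤ h y i + 1
  h_cross : ∀ x y i j, adj x y → h x i ≠ 0 → h y j ≠ 0 → i = j
  h_le : ∀ x i, h x i ≤ bound
  fiber : ∀ x y, h x = h y →
    1 / 4 ≤ height n (leg x) ⌊θ x⌋₊ * bump (θ x - ⌊θ x⌋₊) →
    ⌊θ y⌋₊ % n = ⌊θ x⌋₊ % n ∧ height n (leg x) ⌊θ x⌋₊ * bump (θ x - ⌊θ x⌋₊) - 1 / 8 <
      height n (leg y) ⌊θ y⌋₊ * bump (θ y - ⌊θ y⌋₊)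

namespace Labelling

variable {X : Type*} {n m : ℕ} (D : Labelling X n m)

/-- The index of the tent over a point. -/
noncomputable def s (x : X) : ℕ := ⌊D.θ x⌋₊

/-- The amplitude of the folded map at a point. -/
noncomputable def amp (x : X) : ℝ := height n (D.leg x) (D.s x) * bump (D.θ x - D.s x)

/-- A vertex is colored if some point above it has large amplitude. -/
def Colored (y : Fin m → ℕ) : Prop := ∃ x, D.h x = y ∧ 1 / 4 ≤ D.amp x

/-- Infinite walks along the adjacency relation. -/
def Walk (p : ℕ → X) : Prop := ∀ t, D.adj (p t) (p (t + 1))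

variable {D}

theorem fiber' {x y : X} (hxy : D.h x = D.h y) (hx : 1 / 4 ≤ D.amp x) :
    D.s y % n = D.s x % n ∧ D.amp x - 1 / 8 < D.amp y := D.fiber x y hxy hx

theorem s_le (x : X) : (D.s x : ℝ) ≤ D.θ x := Nat.floor_le (D.θ_nonneg x)

theorem lt_s (x : X) : D.θ x < D.s x + 1 := Nat.lt_floor_add_one _

theorem s_eq {x : X} {k : ℕ} (h1 : (k : ℝ) ≤ D.θ x) (h2 : D.θ x < k + 1) : D.s x = k :=
  (Nat.floor_eq_iff (D.θ_nonneg x)).2 ⟨h1, h2⟩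

theorem Walk.shift {p : ℕ → X} (hp : D.Walk p) (k : ℕ) : D.Walk fun t => p (k + t) :=
  fun t => hp (k + t)

theorem Walk.reverse {p : ℕ → X} (hp : D.Walk p) (k : ℕ) : D.Walk fun t => p (k - t) := by
  intro t
  dsimp only
  rcases Nat.lt_or_ge t k with h | h
  · have e : k - t = (k - (t + 1)) + 1 := by omega
    rw [e]
    exact D.adj_symm _ _ (hp _)
  · rw [Nat.sub_eq_zero_of_le h, Nat.sub_eq_zero_of_le (by omega)]
    exact D.adj_refl _

theorem exists_walk (x y : X) : ∃ p : ℕ → X, D.Walk p ∧ ∃ k, p 0 = x ∧ p k = y := by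
  have := D.chain x y
  induction this with
  | refl => exact ⟨fun _ => x, fun _ => D.adj_refl _, 0, rfl, rfl⟩
  | @tail b c _ hbc ih =>
    obtain ⟨p, hp, k, h0, hk⟩ := ih
    refine ⟨fun t => if t ≤ k then p t else c, fun t => ?_, k + 1, by simpa using h0, by simp⟩
    dsimp only
    rcases lt_trichotomy t k with h | h | h
    · rw [if_pos h.le, if_pos (by omega)]; exact hp t
    · rw [if_pos h.le, if_neg (by omega), h, hk]; exact hbc
    · rw [if_neg (by omega), if_neg (by omega)]; exact D.adj_refl _

theorem h_eq_single {x : X} {i : Fin m} {a : ℕ} (ha : D.h x i = a) (h0 : a ≠ 0) :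
    D.h x = Pi.single i a := by
  ext j
  by_cases hj : j = i
  · subst hj; simpa using ha
  · rw [Pi.single_eq_of_ne hj]
    by_contra hne
    exact hj (D.h_support x j i hne (by omega))

theorem exists_single (hm : 0 < m) (x : X) : ∃ i a, D.h x = Pi.single i a := by
  by_cases hx : ∃ i, D.h x i ≠ 0
  · obtain ⟨i, hi⟩ := hx
    exact ⟨i, _, h_eq_single rfl hi⟩
  · push Not at hx
    exact ⟨⟨0, hm⟩, 0, by ext j; simp [hx j]⟩

theorem hit_down {p : ℕ → X} (hp : D.Walk p) {v u : ℕ} (hvu : v ≤ u) {i : Fin m} {a : ℕ}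
    (hu : D.h (p u) i ≤ a) (hv : a < D.h (p v) i) :
    ∃ t, v < t ∧ t ≤ u ∧ D.h (p t) = Pi.single i a := by
  classical
  have hex : ∃ t, v ≤ t ∧ D.h (p t) i ≤ a := ⟨u, hvu, hu⟩
  obtain ⟨h1, h2⟩ := Nat.find_spec hex
  have h3 : Nat.find hex ≤ u := Nat.find_min' hex ⟨hvu, hu⟩
  obtain ⟨t, ht⟩ : ∃ t, Nat.find hex = t + 1 := by
    refine Nat.exists_eq_succ_of_ne_zero fun h0 => ?_
    have hv0 : v = 0 := by omega
    rw [h0] at h2; rw [hv0] at hv; omega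
  have hne : Nat.find hex ≠ v := by
    intro h; rw [h] at h2; omega
  have h4 : ¬(v ≤ t ∧ D.h (p t) i ≤ a) := Nat.find_min hex (by omega)
  have h5 : a < D.h (p t) i := by
    by_contra h; exact h4 ⟨by omega, by omega⟩
  rw [ht] at h1 h2 h3 hne
  have h6 := D.h_step _ _ i (hp t)
  refine ⟨t + 1, by omega, h3, ?_⟩
  ext j
  by_cases hj : j = i
  · subst hj; simp; omega
  · rw [Pi.single_eq_of_ne hj]
    by_contra hne'
    exact hj (D.h_cross _ _ i j (hp t) (by omega) hne').symm

theorem hit_up {p : ℕ → X} (hp : D.Walk p) {v u : ℕ} (hvu : v ≤ u) {i : Fin m} {a : ℕ}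
    (hv : D.h (p v) i ≤ a) (hu : a < D.h (p u) i) :
    ∃ t, v ≤ t ∧ t < u ∧ D.h (p t) = Pi.single i a := by
  obtain ⟨t, h1, h2, h3⟩ := hit_down (hp.reverse u) (v := 0) (u := u - v) (Nat.zero_le _)
    (i := i) (a := a) (by simpa [Nat.sub_sub_self hvu] using hv) (by simpa using hu)
  exact ⟨u - t, by omega, by omega, h3⟩

theorem hit_up' {p : ℕ → X} (hp : D.Walk p) {v u : ℕ} (hvu : v ≤ u) {i : Fin m} {a : ℕ}
    (hv : D.h (p v) i ≤ a) (hu : a ≤ D.h (p u) i) (h0 : 0 < D.h (p u) i) :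
    ∃ t, v ≤ t ∧ t ≤ u ∧ D.h (p t) = Pi.single i a := by
  rcases hu.lt_or_eq with h | h
  · obtain ⟨t, h1, h2, h3⟩ := hit_up hp hvu hv h
    exact ⟨t, h1, h2.le, h3⟩
  · exact ⟨u, hvu, le_rfl, h_eq_single h.symm (by omega)⟩

theorem abs_le_of_uncolored {x : X} (hx : ¬ D.Colored (D.h x)) :
    ∃ N : ℤ, |D.θ x - N| < 1 / 4 := by
  have h1 : D.amp x < 1 / 4 := by
    by_contra h; exact hx ⟨x, rfl, not_lt.1 h⟩
  have h2 := half_le_height n (D.leg x) (D.s x)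
  have h3 := bump_nonneg (D.θ x - D.s x)
  have h4 : bump (D.θ x - D.s x) < 1 / 2 := by
    unfold amp at h1; nlinarith
  have h5 : 1 - |2 * (D.θ x - D.s x) - 1| < 1 / 2 := lt_of_le_of_lt (le_max_right _ _) h4
  have h6 := D.s_le x
  have h7 := D.lt_s x
  rcases abs_cases (2 * (D.θ x - D.s x) - 1) with ⟨h, _⟩ | ⟨h, _⟩
  · refine ⟨D.s x + 1, ?_⟩
    push_cast
    rw [abs_lt]; constructor <;> linarith
  · refine ⟨D.s x, ?_⟩
    push_cast
    rw [abs_lt]; constructor <;> linarith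

theorem shallow {p : ℕ → X} (hp : D.Walk p) {v u : ℕ} (hvu : v < u)
    (hunc : ∀ t, v < t → t < u → ¬ D.Colored (D.h (p t))) : |D.θ (p v) - D.θ (p u)| < 1 := by
  rcases Nat.lt_or_ge (v + 1) u with h | h
  · obtain ⟨N, hN⟩ := abs_le_of_uncolored (hunc (v + 1) (by omega) h)
    have key : ∀ k, v + 1 + k < u → |D.θ (p (v + 1 + k)) - N| < 1 / 4 := by
      intro k
      induction k with
      | zero => intro _; exact hN
      | succ k ih =>
        intro hk
        have h1 := ih (by omega)
        have h2 := D.θ_step _ _ (hp (v + 1 + k))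
        obtain ⟨N', hN'⟩ := abs_le_of_uncolored (hunc (v + 1 + k + 1) (by omega) (by omega))
        have : N' = N := by
          rw [abs_lt] at h1 h2 hN'
          have a1 : (N' : ℝ) < N + 1 := by linarith
          have a2 : (N : ℝ) < N' + 1 := by linarith
          have b1 : N' < N + 1 := by exact_mod_cast a1
          have b2 : N < N' + 1 := by exact_mod_cast a2
          omega
        rw [← this]; exact hN'
    have h1 := key (u - 1 - (v + 1)) (by omega)
    have e : v + 1 + (u - 1 - (v + 1)) = u - 1 := by omega
    rw [e] at h1
    have h2 := D.θ_step _ _ (hp (u - 1))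
    rw [show u - 1 + 1 = u by omega] at h2
    have h3 := D.θ_step _ _ (hp v)
    rw [abs_lt] at *
    constructor <;> linarith
  · have : u = v + 1 := by omega
    subst this
    exact (D.θ_step _ _ (hp v)).trans (by norm_num)

theorem s_sub_le {x y : X} (h : |D.θ x - D.θ y| < 1) : |(D.s x : ℤ) - D.s y| ≤ 1 := by
  have h1 := D.s_le x
  have h2 := D.lt_s x
  have h3 := D.s_le y
  have h4 := D.lt_s y
  rw [abs_lt] at h
  have a1 : (D.s x : ℝ) < D.s y + 2 := by linarith
  have a2 : (D.s y : ℝ) < D.s x + 2 := by linarith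
  have b1 : D.s x < D.s y + 2 := by exact_mod_cast a1
  have b2 : D.s y < D.s x + 2 := by exact_mod_cast a2
  rw [abs_le]; omega

end Labelling

namespace Labelling

variable {X : Type*} {n m : ℕ} (D : Labelling X n m)

open Classical in
/-- The index of some tent over a colored vertex. -/
noncomputable def rho (y : Fin m → ℕ) : ℕ := if hy : D.Colored y then D.s hy.choose else 0

open Classical in
/-- The integer lift of the coloring along a leg, starting from the value `c` at the centre. -/
noncomputable def kap (c : ℤ) (i : Fin m) : ℕ → ℤ
  | 0 => c
  | t + 1 => if D.Colored (Pi.single i (t + 1)) then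
      kap c i t + ((D.rho (Pi.single i (t + 1)) - kap c i t + 1) % n - 1) else kap c i t

/-- A value at the centre from which the first colored vertices of all legs are approached
from below. -/
def IsBase (c : ℤ) : Prop :=
  (D.Colored 0 → (n : ℤ) ∣ c - D.rho 0) ∧
  (¬ D.Colored 0 → ∀ i t, D.Colored (Pi.single i t) →
    (∀ b < t, ¬ D.Colored (Pi.single i b)) → ¬ (n : ℤ) ∣ D.rho (Pi.single i t) - c + 1)

variable {D}

theorem s_mod_eq {x : X} (hx : D.Colored (D.h x)) : D.s x % n = D.rho (D.h x) % n := by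
  unfold rho
  rw [dif_pos hx]
  exact (D.fiber' hx.choose_spec.1 hx.choose_spec.2).1

theorem exists_isBase (hmn : m < n) : ∃ c, D.IsBase c := by
  classical
  by_cases h0 : D.Colored 0
  · exact ⟨D.rho 0, fun _ => by simp, fun h => absurd h0 h⟩
  · have hn : 0 < n := by omega
    let φ : Fin m → Fin n := fun i =>
      if h : ∃ t, D.Colored (Pi.single i t) then
        ⟨D.rho (Pi.single i (Nat.find h)) % n, Nat.mod_lt _ hn⟩ else ⟨0, hn⟩
    have hφ : ¬ Function.Surjective φ := fun hs => by
      have := Fintype.card_le_of_surjective φ hs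
      simp at this; omega
    unfold Function.Surjective at hφ
    push Not at hφ
    obtain ⟨d, hd⟩ := hφ
    refine ⟨(d : ℕ) + 1, fun h => absurd h h0, fun _ i t ht hb hdvd => hd i ?_⟩
    have hex : ∃ t, D.Colored (Pi.single i t) := ⟨t, ht⟩
    have hf : Nat.find hex = t := (Nat.find_eq_iff hex).2 ⟨ht, fun b hbt => hb b hbt⟩
    apply Fin.ext
    simp only [φ, dif_pos hex, hf]
    have h1 : (n : ℤ) ∣ (D.rho (Pi.single i t) : ℤ) - (d : ℕ) := by
      convert hdvd using 1; ring
    have h3 := Int.emod_eq_emod_iff_emod_sub_eq_zero.2 (Int.emod_eq_zero_of_dvd h1)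
    have h4 : D.rho (Pi.single i t) % n = (d : ℕ) % n := by exact_mod_cast h3
    rw [h4, Nat.mod_eq_of_lt d.2]

theorem kap_succ_bounds (hn : 3 ≤ n) (c : ℤ) (i : Fin m) (t : ℕ) :
    -1 ≤ D.kap c i (t + 1) - D.kap c i t ∧ D.kap c i (t + 1) - D.kap c i t ≤ n - 2 := by
  rw [kap]
  have h1 := Int.emod_nonneg (D.rho (Pi.single i (t + 1)) - D.kap c i t + 1)
    (show (n : ℤ) ≠ 0 by omega)
  have h2 := Int.emod_lt_of_pos (D.rho (Pi.single i (t + 1)) - D.kap c i t + 1)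
    (show (0 : ℤ) < n by omega)
  split_ifs <;> omega

theorem kap_of_uncolored {c : ℤ} {i : Fin m} {t t' : ℕ} (htt : t ≤ t')
    (h : ∀ b, t < b → b ≤ t' → ¬ D.Colored (Pi.single i b)) :
    D.kap c i t' = D.kap c i t := by
  induction t', htt using Nat.le_induction with
  | base => rfl
  | succ k hk ih =>
    rw [kap, if_neg (h _ (by omega) le_rfl)]
    exact ih fun b h1 h2 => h b h1 (by omega)

theorem kap_dvd {c : ℤ} (hc : D.IsBase c) {i : Fin m} {t : ℕ}
    (h : D.Colored (Pi.single i t)) : (n : ℤ) ∣ D.kap c i t - D.rho (Pi.single i t) := by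
  cases t with
  | zero => simpa [kap] using hc.1 (by simpa using h)
  | succ t =>
    rw [kap, if_pos h, Int.emod_def]
    refine ⟨-((D.rho (Pi.single i (t + 1)) - D.kap c i t + 1) / n), ?_⟩
    ring

theorem kap_first {c : ℤ} (hn : 3 ≤ n) (hc : D.IsBase c) {i : Fin m} {t : ℕ} (ht : 0 < t)
    (h : ∀ b < t, ¬ D.Colored (Pi.single i b)) :
    0 ≤ D.kap c i t - c ∧ D.kap c i t - c ≤ n - 2 := by
  obtain ⟨k, rfl⟩ : ∃ k, t = k + 1 := ⟨t - 1, by omega⟩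
  have h0 : D.kap c i k = c :=
    kap_of_uncolored (t := 0) (Nat.zero_le _) fun b _ hb => h b (by omega)
  have h1 := D.kap_succ_bounds hn c i k
  rw [h0] at h1
  refine ⟨?_, h1.2⟩
  rw [kap]
  split_ifs with hcol
  · rw [h0]
    have h2 := hc.2 (by simpa using h 0 ht) i _ hcol h
    have h3 := Int.emod_nonneg ((D.rho (Pi.single i (k + 1)) : ℤ) - c + 1)
      (show (n : ℤ) ≠ 0 by omega)
    have h4 : ((D.rho (Pi.single i (k + 1)) : ℤ) - c + 1) % n ≠ 0 := fun h =>
      h2 (Int.dvd_of_emod_eq_zero h)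
    omega
  · omega

theorem kap_same {c : ℤ} (hn : 3 ≤ n) {i : Fin m} {t t' : ℕ} (htt : t < t')
    (h : ∀ b, t < b → b < t' → ¬ D.Colored (Pi.single i b)) :
    |D.kap c i t' - D.kap c i t| ≤ n - 2 := by
  obtain ⟨k, rfl⟩ : ∃ k, t' = k + 1 := ⟨t' - 1, by omega⟩
  rw [← kap_of_uncolored (t := t) (t' := k) (by omega) fun b h1 h2 => h b h1 (by omega)]
  have := D.kap_succ_bounds hn c i k
  rw [abs_le]; omega

variable (D) in
/-- The lift of the coloring to all vertices. -/
noncomputable def kappa (c : ℤ) (y : Fin m → ℕ) : ℤ := c + ∑ i, (D.kap c i (y i) - c)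

theorem kappa_single (c : ℤ) (i : Fin m) (t : ℕ) :
    D.kappa c (Pi.single i t) = D.kap c i t := by
  unfold kappa
  rw [Finset.sum_eq_single i]
  · simp
  · intro j _ hj
    simp [Pi.single_eq_of_ne hj, kap]
  · simp

theorem kappa_dvd (hm : 0 < m) {c : ℤ} (hc : D.IsBase c) {x : X} (hx : D.Colored (D.h x)) :
    (n : ℤ) ∣ D.kappa c (D.h x) - D.s x := by
  have h1 := s_mod_eq hx
  obtain ⟨i, a, ha⟩ := D.exists_single hm x
  rw [ha] at hx h1
  have h2 := kap_dvd hc hx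
  rw [ha, kappa_single]
  have h3 : (n : ℤ) ∣ (D.s x : ℤ) - D.rho (Pi.single i a) := by
    apply Int.dvd_of_emod_eq_zero
    apply Int.emod_eq_emod_iff_emod_sub_eq_zero.1
    exact_mod_cast h1
  simpa only [sub_sub_sub_cancel_right] using dvd_sub h2 h3

theorem kappa_consecutive (hn : 3 ≤ n) (hm : 0 < m) {c : ℤ} (hc : D.IsBase c) {p : ℕ → X}
    (hp : D.Walk p) {v u : ℕ} (hvu : v < u)
    (hunc : ∀ t, v < t → t < u → ¬ D.Colored (D.h (p t))) :
    |D.kappa c (D.h (p u)) - D.kappa c (D.h (p v))| ≤ n - 2 := by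
  have same : ∀ i t t', D.h (p v) = Pi.single i t → D.h (p u) = Pi.single i t' →
      |D.kappa c (D.h (p u)) - D.kappa c (D.h (p v))| ≤ n - 2 := by
    intro i t t' hv hu
    rw [hv, hu, kappa_single, kappa_single]
    rcases lt_trichotomy t t' with h | h | h
    · refine kap_same hn h fun b h1 h2 => ?_
      obtain ⟨τ, h3, h4, h5⟩ := hit_up hp hvu.le (i := i) (a := b) (by simp [hv]; omega)
        (by simpa [hu])
      rw [← h5]
      refine hunc τ (lt_of_le_of_ne h3 ?_) h4
      rintro rfl
      have := Pi.single_injective i (hv.symm.trans h5)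
      omega
    · subst h; simp; omega
    · rw [abs_sub_comm]
      refine kap_same hn h fun b h1 h2 => ?_
      obtain ⟨τ, h3, h4, h5⟩ := hit_down hp hvu.le (i := i) (a := b) (by simp [hu]; omega)
        (by simpa [hv])
      rw [← h5]
      refine hunc τ h3 (lt_of_le_of_ne h4 ?_)
      rintro rfl
      have := Pi.single_injective i (hu.symm.trans h5)
      omega
  obtain ⟨i, t, hv⟩ := D.exists_single hm (p v)
  obtain ⟨j, t', hu⟩ := D.exists_single hm (p u)
  rcases Nat.eq_zero_or_pos t with rfl | ht
  · exact same j 0 t' (by simpa using hv) hu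
  rcases Nat.eq_zero_or_pos t' with rfl | ht'
  · exact same i t 0 hv (by simpa using hu)
  by_cases hij : i = j
  · subst hij; exact same i t t' hv hu
  have h1 : ∀ b < t, ¬ D.Colored (Pi.single i b) := by
    intro b hb
    obtain ⟨τ, h3, h4, h5⟩ := hit_down hp hvu.le (i := i) (a := b) (by simp [hu, hij])
        (by simpa [hv])
    rw [← h5]
    refine hunc τ h3 (lt_of_le_of_ne h4 ?_)
    rintro rfl
    have := congrFun (hu.symm.trans h5) j
    rw [Pi.single_eq_same, Pi.single_eq_of_ne (Ne.symm hij)] at this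
    omega
  have h2 : ∀ b < t', ¬ D.Colored (Pi.single j b) := by
    intro b hb
    obtain ⟨τ, h3, h4, h5⟩ := hit_up hp hvu.le (i := j) (a := b) (by simp [hv, Ne.symm hij])
        (by simpa [hu])
    rw [← h5]
    refine hunc τ (lt_of_le_of_ne h3 ?_) h4
    rintro rfl
    have := congrFun (hv.symm.trans h5) i
    rw [Pi.single_eq_same, Pi.single_eq_of_ne hij] at this
    omega
  have h3 := kap_first hn hc ht h1
  have h4 := kap_first hn hc ht' h2
  rw [hv, hu, kappa_single, kappa_single, abs_le]
  omega

theorem kappa_sub_s (hn : 3 ≤ n) (hm : 0 < m) {c : ℤ} (hc : D.IsBase c) {p : ℕ → X}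
    (hp : D.Walk p) (k : ℕ) : ∀ v, D.Colored (D.h (p v)) → D.Colored (D.h (p (v + k))) →
      D.kappa c (D.h (p (v + k))) - D.s (p (v + k)) = D.kappa c (D.h (p v)) - D.s (p v) := by
  induction k using Nat.strong_induction_on with
  | _ k ih =>
  intro v hv hu
  rcases Nat.eq_zero_or_pos k with rfl | hk
  · rfl
  by_cases hex : ∃ t, v < t ∧ t < v + k ∧ D.Colored (D.h (p t))
  · obtain ⟨t, h1, h2, h3⟩ := hex
    have e1 := ih (t - v) (by omega) v hv (by rwa [show v + (t - v) = t by omega])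
    have e2 := ih (v + k - t) (by omega) t h3 (by rwa [show t + (v + k - t) = v + k by omega])
    rw [show v + (t - v) = t by omega] at e1
    rw [show t + (v + k - t) = v + k by omega] at e2
    rw [e2, e1]
  · push Not at hex
    have h1 := kappa_consecutive hn hm hc hp (show v < v + k by omega) hex
    have h2 := s_sub_le (shallow hp (show v < v + k by omega) hex)
    have h3 := dvd_sub (kappa_dvd hm hc hu) (kappa_dvd hm hc hv)
    have h4 : |D.kappa c (D.h (p (v + k))) - D.s (p (v + k)) -
        (D.kappa c (D.h (p v)) - D.s (p v))| < n := by
      rw [abs_le] at h1 h2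
      rw [abs_lt]
      omega
    have := Int.eq_zero_of_abs_lt_dvd h3 h4
    omega

/-- The coloring lifts to an integer valued function of the vertices that stays close to `θ`. -/
theorem exists_lift [Nonempty X] (hn : 3 ≤ n) (hm : 0 < m) (hmn : m < n) :
    ∃ κ : (Fin m → ℕ) → ℤ, (∀ x, |D.θ x - κ (D.h x)| ≤ n + 3) ∧
      ∀ x, D.Colored (D.h x) → (D.s x : ℤ) = κ (D.h x) := by
  classical
  by_cases hcol : ∃ x, D.Colored (D.h x)
  · obtain ⟨c, hc⟩ := D.exists_isBase hmn
    obtain ⟨x₀, h₀⟩ := hcol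
    have key : ∀ x, D.Colored (D.h x) →
        (D.s x : ℤ) = D.kappa c (D.h x) - (D.kappa c (D.h x₀) - D.s x₀) := by
      intro x hx
      obtain ⟨p, hp, k, rfl, rfl⟩ := D.exists_walk x₀ x
      have := kappa_sub_s hn hm hc hp k 0 h₀ (by simpa using hx)
      rw [zero_add] at this
      omega
    refine ⟨fun y => D.kappa c y - (D.kappa c (D.h x₀) - D.s x₀), fun x => ?_, key⟩
    have close : ∀ x, D.Colored (D.h x) →
        |D.θ x - (D.kappa c (D.h x) - (D.kappa c (D.h x₀) - D.s x₀) : ℤ)| ≤ 1 := by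
      intro x hx
      rw [← key x hx, abs_le]
      have := D.s_le x
      have := D.lt_s x
      push_cast
      constructor <;> linarith
    by_cases hx : D.Colored (D.h x)
    · refine (close x hx).trans ?_
      have : (0 : ℝ) ≤ n := Nat.cast_nonneg _
      linarith
    · obtain ⟨p, hp, k, rfl, hk⟩ := D.exists_walk x x₀
      have hex : ∃ t, D.Colored (D.h (p t)) := ⟨k, by rwa [hk]⟩
      have h1 := Nat.find_spec hex
      have hpos : 0 < Nat.find hex := by
        refine Nat.pos_of_ne_zero fun h => hx ?_
        rwa [h] at h1
      have hunc : ∀ t, 0 < t → t < Nat.find hex → ¬ D.Colored (D.h (p t)) :=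
        fun t _ ht => Nat.find_min hex ht
      have h2 := kappa_consecutive hn hm hc hp hpos hunc
      have h3 := shallow hp hpos hunc
      have h4 := close _ h1
      have h5 : |((D.kappa c (D.h (p (Nat.find hex))) : ℤ) : ℝ) - D.kappa c (D.h (p 0))| ≤
        n - 2 := by exact_mod_cast h2
      push_cast at h4 ⊢
      rw [abs_lt] at h3
      rw [abs_le] at *
      constructor <;> linarith
  · push Not at hcol
    obtain ⟨x₀⟩ := ‹Nonempty X›
    refine ⟨fun _ => D.s x₀, fun x => ?_, fun x hx => absurd hx (hcol x)⟩
    have h1 := D.s_le x₀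
    have h2 := D.lt_s x₀
    have h3 : (0 : ℝ) ≤ n := Nat.cast_nonneg _
    obtain ⟨p, hp, k, rfl, rfl⟩ := D.exists_walk x x₀
    rcases Nat.eq_zero_or_pos k with rfl | hk
    · push_cast; rw [abs_le]; constructor <;> linarith
    · have h4 := shallow hp hk fun t _ _ => hcol _
      push_cast
      rw [abs_lt] at h4
      rw [abs_le]; constructor <;> linarith

end Labelling

namespace Labelling

variable {X : Type*} {n m : ℕ} {D : Labelling X n m}

theorem exists_subwalk {p : ℕ → X} (hp : D.Walk p) {v u : ℕ} (hvu : v ≤ u) {i : Fin m} {J J' : ℕ}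
    (hJ : J < J') (hv : D.h (p v) i ≤ J) (hu : J' ≤ D.h (p u) i) :
    ∃ a b, v ≤ a ∧ a ≤ b ∧ b ≤ u ∧ D.h (p a) = Pi.single i J ∧ D.h (p b) = Pi.single i J' ∧
      ∀ t, a ≤ t → t ≤ b → ∃ j, J ≤ j ∧ j ≤ J' ∧ D.h (p t) = Pi.single i j := by
  classical
  have hex : ∃ t, v ≤ t ∧ J' ≤ D.h (p t) i := ⟨u, hvu, hu⟩
  obtain ⟨h1, h2⟩ := Nat.find_spec hex
  have h3 : Nat.find hex ≤ u := Nat.find_min' hex ⟨hvu, hu⟩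
  have h4 : ∀ t, v ≤ t → t < Nat.find hex → D.h (p t) i < J' := fun t ht ht' => by
    by_contra h; exact Nat.find_min hex ht' ⟨ht, by omega⟩
  set b := Nat.find hex with hb
  clear_value b
  have h5 : J' = D.h (p b) i := by
    obtain ⟨t, ht1, ht2, ht3⟩ := hit_up' hp h1 (i := i) (a := J') (by omega) h2 (by omega)
    rcases ht2.lt_or_eq with h | rfl
    · have := h4 t ht1 h; rw [ht3, Pi.single_eq_same] at this; omega
    · rw [ht3, Pi.single_eq_same]
  let P : ℕ → Prop := fun t => D.h (p t) i ≤ J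
  have g0 : P v := hv
  have g1 : P (Nat.findGreatest P b) := Nat.findGreatest_spec h1 g0
  have g2 : v ≤ Nat.findGreatest P b := Nat.le_findGreatest h1 g0
  have g3 : Nat.findGreatest P b ≤ b := Nat.findGreatest_le b
  have g4 : ∀ t, Nat.findGreatest P b < t → t ≤ b → J < D.h (p t) i := fun t ht ht' => by
    by_contra h; exact Nat.findGreatest_is_greatest ht ht' (by omega)
  set a := Nat.findGreatest P b with ha
  clear_value a
  obtain ⟨t, ht1, ht2, ht3⟩ := hit_up hp g3 (i := i) (a := J) g1 (by omega)
  have hta : t = a := by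
    by_contra h
    have := g4 t (by omega) ht2.le
    rw [ht3, Pi.single_eq_same] at this; omega
  subst hta
  refine ⟨t, b, g2, g3, h3, ht3, h_eq_single h5.symm (by omega), fun τ h6 h7 => ?_⟩
  rcases h6.lt_or_eq with h | rfl
  · have := g4 τ h h7
    refine ⟨D.h (p τ) i, this.le, ?_, h_eq_single rfl (by omega)⟩
    rcases h7.lt_or_eq with h' | rfl
    · exact (h4 τ (by omega) h').le
    · omega
  · exact ⟨J, le_rfl, hJ.le, ht3⟩

theorem exists_theta_close {p : ℕ → X} (hp : D.Walk p) {c : ℝ} (k : ℕ) : ∀ v,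
    (D.θ (p v) ≤ c ∧ c ≤ D.θ (p (v + k)) ∨ D.θ (p (v + k)) ≤ c ∧ c ≤ D.θ (p v)) →
    ∃ t, v ≤ t ∧ t ≤ v + k ∧ |D.θ (p t) - c| < 1 / 16 := by
  induction k with
  | zero =>
    intro v h
    refine ⟨v, le_rfl, le_rfl, ?_⟩
    have : D.θ (p v) = c := by
      rcases h with h | h
      · exact le_antisymm h.1 h.2
      · exact le_antisymm h.1 h.2
    rw [this, sub_self, abs_zero]; norm_num
  | succ k ih =>
    intro v h
    have hs := D.θ_step _ _ (hp (v + k))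
    by_cases h' : D.θ (p v) ≤ c ∧ c ≤ D.θ (p (v + k)) ∨ D.θ (p (v + k)) ≤ c ∧ c ≤ D.θ (p v)
    · obtain ⟨t, h1, h2, h3⟩ := ih v h'
      exact ⟨t, h1, by omega, h3⟩
    · refine ⟨v + k, by omega, by omega, ?_⟩
      rw [← add_assoc] at h
      rw [abs_lt] at *
      push Not at h'
      rcases h with h | h
      · have := h'.1 h.1
        constructor <;> linarith
      · have : c < D.θ (p (v + k)) := by
          by_contra hc; exact absurd (h'.2 (by linarith)) (by linarith)
        constructor <;> linarith

/-- A walk traverses the positions from `J` to `J'` on leg `i`, in one of the two directions. -/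
def Spans (D : Labelling X n m) (p : ℕ → X) (v u : ℕ) (i : Fin m) (J J' : ℕ) : Prop :=
  D.h (p v) i ≤ J ∧ J' ≤ D.h (p u) i ∨ D.h (p u) i ≤ J ∧ J' ≤ D.h (p v) i

theorem exists_word_position {i : ℕ} (hi : i < n) {lo : ℝ} (hlo : 0 ≤ lo) :
    ∃ s : ℕ, (s / n) % n = i ∧ lo ≤ s + 1 / 2 ∧ (s + 1 / 2 : ℝ) ≤ lo + n ^ 2 := by
  have hn : 0 < n := by omega
  have hnn : (0 : ℝ) < (n : ℝ) ^ 2 := by positivity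
  have hin : (i : ℝ) + 1 ≤ n := by exact_mod_cast hi
  have hn1 : (1 : ℝ) ≤ n := by exact_mod_cast hn
  refine ⟨n * (n * ⌈(lo - (n * i + 1 / 2)) / n ^ 2⌉₊ + i), ?_, ?_, ?_⟩
  · rw [Nat.mul_div_cancel_left _ hn, Nat.mul_add_mod, Nat.mod_eq_of_lt hi]
  · have := Nat.le_ceil ((lo - (n * i + 1 / 2)) / (n : ℝ) ^ 2)
    rw [div_le_iff₀ hnn] at this
    push_cast
    nlinarith
  · rcases le_or_gt ((lo - (n * i + 1 / 2)) / (n : ℝ) ^ 2) 0 with h | h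
    · rw [Nat.ceil_eq_zero.2 h]
      push_cast
      nlinarith
    · have := Nat.ceil_lt_add_one h.le
      rw [← sub_lt_iff_lt_add, lt_div_iff₀ hnn] at this
      push_cast
      nlinarith

theorem Spans.forward {p : ℕ → X} (hp : D.Walk p) {v u : ℕ} (hvu : v ≤ u) {i : Fin m} {J J' : ℕ}
    (hs : Spans D p v u i J J') : ∃ q v' u', D.Walk q ∧ v' ≤ u' ∧ D.h (q v') i ≤ J ∧
      J' ≤ D.h (q u') i ∧ ∀ t, v' ≤ t → t ≤ u' → ∃ τ, v ≤ τ ∧ τ ≤ u ∧ q t = p τ := by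
  rcases hs with h | h
  · exact ⟨p, v, u, hp, hvu, h.1, h.2, fun t h1 h2 => ⟨t, h1, h2, rfl⟩⟩
  · refine ⟨_, 0, u - v, hp.reverse u, Nat.zero_le _, by simpa using h.1,
      by simpa [Nat.sub_sub_self hvu] using h.2, fun t h1 h2 => ⟨u - t, by omega, by omega, rfl⟩⟩

/-- Two walks staying on different legs of the first star cannot both span a long stretch of a leg
of the second star. -/
theorem marks {κ : (Fin m → ℕ) → ℤ} (h1κ : ∀ x, |D.θ x - κ (D.h x)| ≤ n + 3)
    (h2κ : ∀ x, D.Colored (D.h x) → (D.s x : ℤ) = κ (D.h x))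
    {p q : ℕ → X} (hp : D.Walk p) (hq : D.Walk q) {v u v' u' : ℕ} (hvu : v ≤ u) (hvu' : v' ≤ u')
    {a b : ℕ} (hab : a ≠ b) (ha : ∀ t, v ≤ t → t ≤ u → D.leg (p t) = a)
    (hb : ∀ t, v' ≤ t → t ≤ u' → D.leg (q t) = b) {i : Fin m} {J J' : ℕ} (hJ : J < J')
    (hps : Spans D p v u i J J') (hqs : Spans D q v' u' i J J')
    (hw : (n : ℤ) ^ 2 + 2 * (n + 3) ≤ |κ (Pi.single i J) - κ (Pi.single i J')|) : False := by
  obtain ⟨p, v, u, hp, hvu, hpv, hpu, hP⟩ := hps.forward hp hvu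
  replace ha : ∀ t, v ≤ t → t ≤ u → D.leg (p t) = a := fun t h1 h2 => by
    obtain ⟨τ, h3, h4, h5⟩ := hP t h1 h2
    rw [h5]; exact ha τ h3 h4
  obtain ⟨q, v', u', hq, hvu', hqv, hqu, hQ⟩ := hqs.forward hq hvu'
  replace hb : ∀ t, v' ≤ t → t ≤ u' → D.leg (q t) = b := fun t h1 h2 => by
    obtain ⟨τ, h3, h4, h5⟩ := hQ t h1 h2
    rw [h5]; exact hb τ h3 h4
  clear hP hQ
  obtain ⟨c, d, hvc, hcd, hdu, hc, hd, hmid⟩ := exists_subwalk hp hvu hJ hpv hpu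
  have hc1 := h1κ (p c)
  have hd1 := h1κ (p d)
  rw [hc] at hc1
  rw [hd] at hd1
  have hw' : (n : ℝ) ^ 2 + 2 * (n + 3) ≤ |(κ (Pi.single i J) : ℝ) - κ (Pi.single i J')| := by
    exact_mod_cast hw
  have hlen : (n : ℝ) ^ 2 ≤ |D.θ (p c) - D.θ (p d)| := by
    rw [abs_le] at hc1 hd1
    rcases le_abs.1 hw' with h | h
    · exact le_abs.2 (Or.inl (by linarith))
    · exact le_abs.2 (Or.inr (by linarith))
  have han : a < n := by rw [← ha c hvc (by omega)]; exact D.leg_lt _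
  obtain ⟨s, hs1, hs2, hs3⟩ := exists_word_position han
    (le_min (D.θ_nonneg (p c)) (D.θ_nonneg (p d)))
  obtain ⟨t, ht1, ht2, ht3⟩ := exists_theta_close hp (c := s + 1 / 2) (d - c) c (by
    rw [show c + (d - c) = d by omega]
    rcases le_total (D.θ (p c)) (D.θ (p d)) with h | h
    · rw [min_eq_left h] at hs2 hs3
      rw [abs_sub_comm, abs_of_nonneg (by linarith)] at hlen
      exact Or.inl ⟨hs2, by linarith⟩
    · rw [min_eq_right h] at hs2 hs3
      rw [abs_of_nonneg (by linarith)] at hlen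
      exact Or.inr ⟨hs2, by linarith⟩)
  rw [abs_lt] at ht3
  have hst : D.s (p t) = s := s_eq (by linarith) (by linarith)
  have hamp : 7 / 8 ≤ D.amp (p t) := by
    unfold amp
    rw [hst, height, if_pos (by rw [ha t (by omega) (by omega)]; exact hs1), one_mul]
    refine le_trans ?_ (le_max_right _ _)
    have : |2 * (D.θ (p t) - s) - 1| ≤ 1 / 8 := by rw [abs_le]; constructor <;> linarith
    linarith
  obtain ⟨j, hj1, hj2, hj3⟩ := hmid t ht1 (by omega)
  obtain ⟨τ, hτ1, hτ2, hτ3⟩ := hit_up' hq hvu' (i := i) (a := j) (by omega) (by omega) (by omega)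
  have hh : D.h (p t) = D.h (q τ) := hj3.trans hτ3.symm
  have hcol : D.Colored (D.h (p t)) := ⟨p t, rfl, by linarith⟩
  have hsq : D.s (q τ) = s := by
    have e1 := h2κ _ hcol
    rw [hh] at hcol
    have e2 := h2κ _ hcol
    rw [← hh, ← e1, hst] at e2
    exact_mod_cast e2
  have hampq := (fiber' hh (by linarith)).2
  have hb1 := bump_le_one (D.θ (q τ) - D.s (q τ))
  have hb0 := bump_nonneg (D.θ (q τ) - D.s (q τ))
  have e : D.amp (q τ) = height n (D.leg (q τ)) (D.s (q τ)) * bump (D.θ (q τ) - D.s (q τ)) := rfl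
  rw [height, hsq, hb τ hτ1 hτ2, if_neg (by rw [hs1]; exact hab)] at e
  rw [hsq] at hb1 hb0
  linarith

open Classical in
/-- The extent of the part of leg `i` on which the lift stays close to its value at the centre. -/
noncomputable def reach (D : Labelling X n m) (κ : (Fin m → ℕ) → ℤ) (i : Fin m) : ℕ :=
  Nat.findGreatest (fun t => ∀ t' ≤ t, |κ (Pi.single i t') - κ 0| ≤ (n : ℤ) ^ 2 + 2 * (n + 3))
    D.bound

theorem kappa_of_le_reach {κ : (Fin m → ℕ) → ℤ} {i : Fin m} {t : ℕ} (ht : t ≤ D.reach κ i) :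
    |κ (Pi.single i t) - κ 0| ≤ (n : ℤ) ^ 2 + 2 * (n + 3) := by
  classical
  have := Nat.findGreatest_spec (P := fun t => ∀ t' ≤ t, |κ (Pi.single i t') - κ 0| ≤
    (n : ℤ) ^ 2 + 2 * (n + 3)) (Nat.zero_le D.bound) (by
      intro t' ht'
      obtain rfl : t' = 0 := by omega
      simp only [Pi.single_zero, sub_self, abs_zero]; positivity)
  exact this t ht

theorem exists_of_reach_lt {κ : (Fin m → ℕ) → ℤ} {i : Fin m} {j : ℕ} (hj : D.reach κ i < j)
    (hb : j ≤ D.bound) :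
    ∃ t' ≤ j, (n : ℤ) ^ 2 + 2 * (n + 3) < |κ (Pi.single i t') - κ 0| := by
  classical
  have := Nat.findGreatest_is_greatest (P := fun t => ∀ t' ≤ t, |κ (Pi.single i t') - κ 0| ≤
    (n : ℤ) ^ 2 + 2 * (n + 3)) hj hb
  push Not at this
  exact this

end Labelling

namespace Labelling

variable {X : Type*} {n m : ℕ} {D : Labelling X n m}

/-- The vertex `y` lies outside the part of the star that is collapsed to the centre. -/
def Far (D : Labelling X n m) (κ : (Fin m → ℕ) → ℤ) (y : Fin m → ℕ) : Prop :=
  ∃ i, D.reach κ i < y i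

/-- The quotient map collapsing the vertices within reach to the centre. -/
noncomputable def collapse (D : Labelling X n m) (κ : (Fin m → ℕ) → ℤ) (y : Fin m → ℕ) :
    Fin m → ℕ :=
  fun i => y i - D.reach κ i

/-- The class of `y` sits at a large value of the lift. -/
def High (D : Labelling X n m) (κ : (Fin m → ℕ) → ℤ) (y : Fin m → ℕ) : Prop :=
  D.Far κ y ∧ 2 * ((n : ℤ) ^ 2 + 2 * (n + 3)) + (n + 3) + 1 ≤ κ y ∨
  ¬ D.Far κ y ∧ 2 * ((n : ℤ) ^ 2 + 2 * (n + 3)) + (n + 3) + 1 ≤ κ 0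

variable {κ : (Fin m → ℕ) → ℤ}

theorem far_of_collapse_eq {y y' : Fin m → ℕ} (h : D.collapse κ y = D.collapse κ y')
    (hy : D.Far κ y) : D.Far κ y' := by
  obtain ⟨i, hi⟩ := hy
  have := congrFun h i
  unfold collapse at this
  exact ⟨i, by omega⟩

theorem h_eq_of_collapse_eq {x x' : X} (h : D.collapse κ (D.h x) = D.collapse κ (D.h x'))
    (hx : D.Far κ (D.h x)) : D.h x = D.h x' := by
  obtain ⟨i, hi⟩ := hx
  have := congrFun h i
  unfold collapse at this
  rw [h_eq_single (x := x) (i := i) rfl (by omega), h_eq_single (x := x') (i := i) rfl (by omega)]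
  congr 1; omega

theorem high_of_collapse_eq {x x' : X} (h : D.collapse κ (D.h x) = D.collapse κ (D.h x'))
    (hx : D.High κ (D.h x)) : D.High κ (D.h x') := by
  rcases hx with ⟨h1, h2⟩ | ⟨h1, h2⟩
  · exact Or.inl ⟨far_of_collapse_eq h h1, by rwa [← h_eq_of_collapse_eq h h1]⟩
  · exact Or.inr ⟨fun h3 => h1 (far_of_collapse_eq h.symm h3), h2⟩

theorem collapse_of_not_far {y : Fin m → ℕ} (hy : ¬ D.Far κ y) : D.collapse κ y = 0 := by
  ext i
  unfold Far at hy
  push Not at hy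
  have := hy i
  simp only [collapse, Pi.zero_apply]; omega

theorem not_far_zero : ¬ D.Far κ 0 := by rintro ⟨i, hi⟩; simp at hi

theorem kappa_of_not_far (hm : 0 < m) {x : X} (hx : ¬ D.Far κ (D.h x)) :
    |κ (D.h x) - κ 0| ≤ (n : ℤ) ^ 2 + 2 * (n + 3) := by
  obtain ⟨i, a, ha⟩ := D.exists_single hm x
  unfold Far at hx
  push Not at hx
  have := hx i
  rw [ha] at this ⊢
  exact kappa_of_le_reach (by simpa using this)

theorem theta_of_high (hm : 0 < m) (h1κ : ∀ x, |D.θ x - κ (D.h x)| ≤ n + 3) {x : X}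
    (hx : D.High κ (D.h x)) : 1 < D.θ x := by
  have h1 := h1κ x
  rw [abs_le] at h1
  have h0 : (0 : ℝ) ≤ n := Nat.cast_nonneg n
  rcases hx with ⟨h2, h3⟩ | ⟨h2, h3⟩
  · have h4 : (2 * ((n : ℝ) ^ 2 + 2 * (n + 3)) + (n + 3) + 1) ≤ κ (D.h x) := by exact_mod_cast h3
    nlinarith
  · have h5 : |(κ (D.h x) : ℝ) - κ 0| ≤ (n : ℝ) ^ 2 + 2 * (n + 3) := by
      exact_mod_cast kappa_of_not_far hm h2
    have h4 : (2 * ((n : ℝ) ^ 2 + 2 * (n + 3)) + (n + 3) + 1) ≤ κ 0 := by exact_mod_cast h3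
    rw [abs_le] at h5
    nlinarith

theorem exists_first_last {p : ℕ → X} (hp : D.Walk p) {r : ℕ} (h0 : 1 < D.θ (p 0))
    (hr : 1 < D.θ (p r)) (hleg : D.leg (p 0) ≠ D.leg (p r)) :
    ∃ u v, 0 < u ∧ u ≤ v ∧ v < r ∧ D.θ (p u) ≤ 1 ∧ D.θ (p v) ≤ 1 ∧
      (∀ t, 0 ≤ t → t ≤ u → D.leg (p t) = D.leg (p 0)) ∧
      ∀ t, v ≤ t → t ≤ r → D.leg (p t) = D.leg (p r) := by
  classical
  have hex : ∃ t, t ≤ r ∧ D.θ (p t) ≤ 1 := by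
    by_contra hcon
    push Not at hcon
    have : ∀ t, t ≤ r → D.leg (p t) = D.leg (p 0) := by
      intro t
      induction t with
      | zero => intro _; rfl
      | succ t ih =>
        intro ht
        rw [← ih (by omega)]
        by_contra hne
        have := D.leg_step _ _ (hp t) (Ne.symm hne)
        linarith [hcon t (by omega)]
    exact hleg (this r le_rfl).symm
  let P : ℕ → Prop := fun t => D.θ (p t) ≤ 1
  obtain ⟨h1, h2⟩ := Nat.find_spec hex
  have hmin : ∀ t, t < Nat.find hex → 1 < D.θ (p t) := fun t ht => by
    by_contra h; exact Nat.find_min hex ht ⟨by omega, not_lt.1 h⟩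
  have g1 : P (Nat.findGreatest P r) := Nat.findGreatest_spec h1 h2
  have g2 : Nat.find hex ≤ Nat.findGreatest P r := Nat.le_findGreatest h1 h2
  have g3 : Nat.findGreatest P r ≤ r := Nat.findGreatest_le r
  have g4 : ∀ t, Nat.findGreatest P r < t → t ≤ r → 1 < D.θ (p t) := fun t ht ht' => by
    by_contra h; exact Nat.findGreatest_is_greatest ht ht' (not_lt.1 h)
  refine ⟨Nat.find hex, Nat.findGreatest P r, ?_, g2, ?_, h2, g1, ?_, ?_⟩
  · refine Nat.pos_of_ne_zero fun h => ?_
    rw [h] at h2; linarith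
  · refine lt_of_le_of_ne g3 fun h => ?_
    rw [h] at g1; exact absurd hr (not_lt.2 g1)
  · intro t _
    induction t with
    | zero => intro _; rfl
    | succ t ih =>
      intro ht
      rw [← ih (Nat.zero_le _) (by omega)]
      by_contra hne
      have := D.leg_step _ _ (hp t) (Ne.symm hne)
      linarith [hmin t (by omega)]
  · intro t ht htr
    obtain ⟨k, rfl⟩ : ∃ k, t = r - k := ⟨r - t, by omega⟩
    clear htr
    induction k with
    | zero => rfl
    | succ k ih =>
      rcases Nat.lt_or_ge k r with hkr | hkr
      · rw [← ih (by omega)]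
        by_contra hne
        have hs := hp (r - (k + 1))
        rw [show r - (k + 1) + 1 = r - k by omega] at hs
        have := D.leg_step _ _ hs hne
        linarith [g4 (r - k) (by omega) (by omega)]
      · rw [← ih (by omega), Nat.sub_eq_zero_of_le hkr, Nat.sub_eq_zero_of_le (by omega)]

theorem no_high_walk (hm : 0 < m) (h1κ : ∀ x, |D.θ x - κ (D.h x)| ≤ n + 3)
    (h2κ : ∀ x, D.Colored (D.h x) → (D.s x : ℤ) = κ (D.h x)) (r : ℕ) : ∀ p : ℕ → X, D.Walk p →
    D.collapse κ (D.h (p 0)) = D.collapse κ (D.h (p r)) → D.High κ (D.h (p 0)) →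
    D.leg (p 0) = D.leg (p r) := by
  induction r using Nat.strong_induction_on with
  | _ r ih =>
  intro p hp hcls hE
  by_contra hleg
  have hE' := high_of_collapse_eq hcls hE
  obtain ⟨u, v, hu0, huv, hvr, hθu, hθv, hl1, hl2⟩ := exists_first_last hp
    (theta_of_high hm h1κ hE) (theta_of_high hm h1κ hE') hleg
  have split : ∀ t, 0 < t → t < r → D.collapse κ (D.h (p t)) = D.collapse κ (D.h (p 0)) →
      False := by
    intro t ht0 htr ht
    by_cases h : D.leg (p 0) = D.leg (p t)
    · refine hleg (h.trans ?_)
      have := ih (r - t) (by omega) _ (hp.shift t)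
        (by simpa [show t + (r - t) = r by omega] using ht.trans hcls)
        (high_of_collapse_eq (by simpa using ht.symm) hE)
      simpa [show t + (r - t) = r by omega] using this
    · exact h (ih t htr p hp ht.symm hE)
  obtain ⟨w, hw⟩ : ∃ w : ℤ, w = (n : ℤ) ^ 2 + 2 * (n + 3) := ⟨_, rfl⟩
  have hw0 : (n : ℤ) + 3 < w ∧ 0 < w := by
    have : (0 : ℤ) ≤ (n : ℤ) ^ 2 := by positivity
    constructor <;> omega
  have low : ∀ {x : X}, D.θ x ≤ 1 → κ (D.h x) ≤ n + 3 + 1 := by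
    intro x hx
    have := h1κ x
    rw [abs_le] at this
    have h3 : (κ (D.h x) : ℝ) ≤ n + 3 + 1 := by linarith
    exact_mod_cast h3
  have hκu := low hθu
  have hκv := low hθv
  have mk : ∀ i J J', J < J' → Spans D p 0 u i J J' → Spans D p v r i J J' →
      w ≤ |κ (Pi.single i J) - κ (Pi.single i J')| → False := fun i J J' hJ h1 h2 h3 =>
    marks h1κ h2κ hp hp hu0.le hvr.le hleg hl1 hl2 hJ h1 h2 (hw ▸ h3)
  unfold High at hE
  rw [← hw] at hE
  rcases hE with ⟨hfar, hκ⟩ | ⟨hfar, hκ⟩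
  · have heq := h_eq_of_collapse_eq hcls hfar
    obtain ⟨i, hi⟩ := hfar
    obtain ⟨j, hj⟩ : ∃ j, j = D.h (p 0) i := ⟨_, rfl⟩
    have hj0 : 0 < j := by omega
    have hp0 : D.h (p 0) = Pi.single i j := h_eq_single hj.symm (by omega)
    have hpr : D.h (p r) i = j := by rw [← heq, hj]
    rw [hp0] at hκ
    have hne : ∀ {x : X}, κ (D.h x) ≤ n + 3 + 1 → D.h x i ≠ j := by
      intro x hx h
      rw [h_eq_single h (by omega)] at hx
      omega
    have single_u : ∀ {J}, D.h (p u) i = J → 0 < J → κ (Pi.single i J) ≤ n + 3 + 1 := by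
      intro J h1 h2
      rw [← h_eq_single h1 (by omega)]; exact hκu
    have single_v : ∀ {J}, D.h (p v) i = J → 0 < J → κ (Pi.single i J) ≤ n + 3 + 1 := by
      intro J h1 h2
      rw [← h_eq_single h1 (by omega)]; exact hκv
    have hnu := hne hκu
    have hnv := hne hκv
    have cross : ∀ t, u ≤ t → t ≤ v → D.h (p t) = Pi.single i j → False := fun t h1 h2 h3 =>
      split t (by omega) (by omega) (by rw [h3, hp0])
    rcases lt_or_gt_of_ne hnu with h1 | h1 <;> rcases lt_or_gt_of_ne hnv with h2 | h2
    · rcases Nat.eq_zero_or_pos (max (D.h (p u) i) (D.h (p v) i)) with h3 | h3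
      · obtain ⟨t', ht1, ht2⟩ := exists_of_reach_lt (D := D) (κ := κ) (i := i) (j := j)
          (by omega) (by rw [hj]; exact D.h_le _ _)
        rw [← hw] at ht2
        have ht0 : 0 < t' := by
          refine Nat.pos_of_ne_zero fun h => ?_
          subst h
          simp at ht2; omega
        refine mk i 0 t' ht0 (Or.inr ⟨by omega, by omega⟩) (Or.inl ⟨by omega, by omega⟩) ?_
        rw [Pi.single_zero, abs_sub_comm]; exact ht2.le
      · have hκJ : κ (Pi.single i (max (D.h (p u) i) (D.h (p v) i))) ≤ n + 3 + 1 := by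
          rcases max_choice (D.h (p u) i) (D.h (p v) i) with h | h
          · exact single_u h.symm h3
          · exact single_v h.symm h3
        refine mk i _ j (max_lt h1 h2) (Or.inr ⟨by omega, by omega⟩)
          (Or.inl ⟨by omega, by omega⟩) (le_abs.2 (Or.inr ?_))
        omega
    · obtain ⟨t, ht1, ht2, ht3⟩ := hit_up hp huv h1.le h2
      exact cross t ht1 ht2.le ht3
    · obtain ⟨t, ht1, ht2, ht3⟩ := hit_down hp huv h2.le h1
      exact cross t ht1.le ht2 ht3
    · have hκJ : κ (Pi.single i (min (D.h (p u) i) (D.h (p v) i))) ≤ n + 3 + 1 := by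
        rcases min_choice (D.h (p u) i) (D.h (p v) i) with h | h
        · exact single_u h.symm (by omega)
        · exact single_v h.symm (by omega)
      refine mk i j _ (lt_min h1 h2) (Or.inl ⟨by omega, by omega⟩)
        (Or.inr ⟨by omega, by omega⟩) (le_abs.2 (Or.inl ?_))
      omega
  · have hfar' : ¬ D.Far κ (D.h (p r)) := fun h => hfar (far_of_collapse_eq hcls.symm h)
    have far_low : ∀ {x : X}, κ (D.h x) ≤ n + 3 + 1 → D.Far κ (D.h x) := by
      intro x hx
      by_contra h
      have := kappa_of_not_far hm h
      rw [← hw, abs_le] at this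
      omega
    obtain ⟨i, hi⟩ := far_low hκu
    obtain ⟨j, hj⟩ := far_low hκv
    unfold Far at hfar hfar'
    push Not at hfar hfar'
    by_cases hij : i = j
    · subst hij
      have h3 := hfar i
      have h4 := hfar' i
      have hκJ : κ (Pi.single i (min (D.h (p u) i) (D.h (p v) i))) ≤ n + 3 + 1 := by
        rcases min_choice (D.h (p u) i) (D.h (p v) i) with h | h
        · rw [h, ← h_eq_single (x := p u) rfl (by omega)]; exact hκu
        · rw [h, ← h_eq_single (x := p v) rfl (by omega)]; exact hκv
      have h5 := kappa_of_le_reach (D := D) (κ := κ) (i := i) (t := D.reach κ i) le_rfl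
      rw [← hw, abs_le] at h5
      refine mk i (D.reach κ i) _ (lt_min hi hj) (Or.inl ⟨by omega, by omega⟩)
        (Or.inr ⟨by omega, by omega⟩) (le_abs.2 (Or.inl ?_))
      omega
    · have hv0 : D.h (p v) i = 0 := by
        by_contra h
        exact hij (D.h_support _ _ _ h (by omega))
      obtain ⟨t, ht1, ht2, ht3⟩ := hit_down hp huv (i := i) (a := 0) hv0.le (by omega)
      refine split t (by omega) (by omega) ?_
      rw [ht3, Pi.single_zero, collapse_of_not_far not_far_zero,
        collapse_of_not_far (fun ⟨i, hi⟩ => absurd hi (not_lt.2 (hfar i)))]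

/-- After collapsing a part of the star around its centre, the fibres of the labelling become
small with respect to the other map. -/
theorem exists_collapse [Nonempty X] (D : Labelling X n m) (hn : 3 ≤ n) (hm : 0 < m)
    (hmn : m < n) : ∃ r : Fin m → ℕ, ∀ x y, (∀ i, D.h x i - r i = D.h y i - r i) →
      D.leg x = D.leg y ∧ |D.θ x - D.θ y| ≤ 9 * n ^ 2 ∨ D.θ x ≤ 9 * n ^ 2 ∧ D.θ y ≤ 9 * n ^ 2 := by
  obtain ⟨κ, h1κ, h2κ⟩ := D.exists_lift hn hm hmn
  refine ⟨D.reach κ, fun x y hxy => ?_⟩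
  have hcls : D.collapse κ (D.h x) = D.collapse κ (D.h y) := funext hxy
  have hn' : (3 : ℝ) ≤ n := by exact_mod_cast hn
  have hx := h1κ x
  have hy := h1κ y
  rw [abs_le] at hx hy
  by_cases hleg : D.leg x = D.leg y
  · refine Or.inl ⟨hleg, ?_⟩
    by_cases hfar : D.Far κ (D.h x)
    · rw [h_eq_of_collapse_eq hcls hfar] at hx
      rw [abs_le]
      constructor <;> nlinarith
    · have hfar' : ¬ D.Far κ (D.h y) := fun h => hfar (far_of_collapse_eq hcls.symm h)
      have h3 : |(κ (D.h x) : ℝ) - κ 0| ≤ (n : ℝ) ^ 2 + 2 * (n + 3) := by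
        exact_mod_cast kappa_of_not_far hm hfar
      have h4 : |(κ (D.h y) : ℝ) - κ 0| ≤ (n : ℝ) ^ 2 + 2 * (n + 3) := by
        exact_mod_cast kappa_of_not_far hm hfar'
      rw [abs_le] at *
      constructor <;> nlinarith
  · refine Or.inr ?_
    have hE : ∀ x y, D.collapse κ (D.h x) = D.collapse κ (D.h y) → D.leg x ≠ D.leg y →
        D.θ x ≤ 9 * n ^ 2 := by
      intro x y hcls hleg
      have hx := h1κ x
      rw [abs_le] at hx
      have hE : ¬ D.High κ (D.h x) := fun hE => by
        obtain ⟨p, hp, r, rfl, rfl⟩ := D.exists_walk x y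
        exact hleg (no_high_walk hm h1κ h2κ r p hp hcls hE)
      unfold High at hE
      push Not at hE
      by_cases hfar : D.Far κ (D.h x)
      · have h3 : (κ (D.h x) : ℝ) < 2 * ((n : ℝ) ^ 2 + 2 * (n + 3)) + (n + 3) + 1 := by
          exact_mod_cast hE.1 hfar
        nlinarith
      · have h3 : (κ 0 : ℝ) < 2 * ((n : ℝ) ^ 2 + 2 * (n + 3)) + (n + 3) + 1 := by
          exact_mod_cast hE.2 hfar
        have h4 : |(κ (D.h x) : ℝ) - κ 0| ≤ (n : ℝ) ^ 2 + 2 * (n + 3) := by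
          exact_mod_cast kappa_of_not_far hm hfar
        rw [abs_le] at h4
        nlinarith
    exact ⟨hE x y hcls hleg, hE y x hcls.symm (Ne.symm hleg)⟩

end Labelling

theorem bump_eq_zero {u : ℝ} (hu : u ≤ 0 ∨ 1 ≤ u) : bump u = 0 := by
  refine max_eq_left ?_
  rcases hu with h | h
  · have := neg_abs_le (2 * u - 1); linarith
  · have := le_abs_self (2 * u - 1); linarith

theorem bump_of_le {u : ℝ} (h0 : 0 ≤ u) (h1 : u ≤ 1 / 2) : bump u = 2 * u := by
  unfold bump
  rw [abs_of_nonpos (by linarith), max_eq_right (by linarith)]; ring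

theorem bump_of_ge {u : ℝ} (h0 : 1 / 2 ≤ u) (h1 : u ≤ 1) : bump u = 2 - 2 * u := by
  unfold bump
  rw [abs_of_nonneg (by linarith), max_eq_right (by linarith)]; ring

theorem continuous_bump : Continuous bump := by
  unfold bump; fun_prop

/-- The star with `n` legs, as a subset of the cube. -/
def Star (n : ℕ) : Set (Fin n → ℝ) :=
  {x | (∀ i, 0 ≤ x i ∧ x i ≤ 1) ∧ ∀ i j, i ≠ j → x i = 0 ∨ x j = 0}

/-- The folding map, described by words of length `W + 1`. -/
noncomputable def fold (n W : ℕ) (x : Fin n → ℝ) (j : Fin n) : ℝ :=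
  ∑ i : Fin n, ∑ s ∈ Finset.range (W + 1),
    if s % n = j then height n i s * bump (W * x i - s) else 0

theorem continuous_fold (n W : ℕ) : Continuous (fold n W) := by
  refine continuous_pi fun j => ?_
  unfold fold
  refine continuous_finsetSum _ fun i _ => continuous_finsetSum _ fun s _ => ?_
  split_ifs
  · exact continuous_const.mul (continuous_bump.comp (by fun_prop))
  · exact continuous_const

section
variable {n : ℕ}

theorem single_mem_Star {i : Fin n} {t : ℝ} (h0 : 0 ≤ t) (h1 : t ≤ 1) :
    (Pi.single i t : Fin n → ℝ) ∈ Star n := by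
  refine ⟨fun j => ?_, fun j k hjk => ?_⟩
  · by_cases hj : j = i
    · subst hj; simp [h0, h1]
    · simp [Pi.single_eq_of_ne hj]
  · by_cases hj : j = i
    · right; exact Pi.single_eq_of_ne (fun h => hjk (hj.trans h.symm)) _
    · left; exact Pi.single_eq_of_ne hj _

theorem zero_mem_Star : (0 : Fin n → ℝ) ∈ Star n := ⟨fun _ => by simp, fun _ _ _ => Or.inl rfl⟩

/-- The distance from the centre of the star. -/
def size (x : Fin n → ℝ) : ℝ := ∑ i, x i

theorem continuous_size : Continuous (size (n := n)) := by unfold size; fun_prop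

theorem size_single (i : Fin n) (t : ℝ) : size (Pi.single i t : Fin n → ℝ) = t := by
  simp [size]

theorem dist_single (i : Fin n) (t t' : ℝ) :
    dist (Pi.single i t : Fin n → ℝ) (Pi.single i t') = |t - t'| := by
  refine le_antisymm ((dist_pi_le_iff (abs_nonneg _)).2 fun j => ?_) ?_
  · by_cases hj : j = i
    · subst hj; simp [Real.dist_eq]
    · simp [Pi.single_eq_of_ne hj]
  · have := dist_le_pi_dist (Pi.single i t : Fin n → ℝ) (Pi.single i t') i
    simpa [Real.dist_eq] using this

variable [NeZero n]

open Classical in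
/-- The leg containing a point of the star. -/
noncomputable def legOf (x : Fin n → ℝ) : Fin n := if h : ∃ i, x i ≠ 0 then h.choose else 0

theorem eq_single {x : Fin n → ℝ} (hx : x ∈ Star n) : x = Pi.single (legOf x) (size x) := by
  have key : x = Pi.single (legOf x) (x (legOf x)) := by
    ext j
    by_cases hj : j = legOf x
    · rw [hj]; simp
    · rw [Pi.single_eq_of_ne hj]
      by_contra hne
      have hex : ∃ i, x i ≠ 0 := ⟨j, hne⟩
      have h1 : x (legOf x) ≠ 0 := by
        unfold legOf; rw [dif_pos hex]; exact hex.choose_spec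
      rcases hx.2 j _ hj with h | h
      · exact hne h
      · exact h1 h
  have h2 : size x = x (legOf x) := by
    conv_lhs => rw [key]
    exact size_single _ _
  rw [h2]; exact key

theorem size_apply {x : Fin n → ℝ} (hx : x ∈ Star n) : size x = x (legOf x) := by
  simpa using (congrFun (eq_single hx) (legOf x)).symm

theorem size_nonneg {x : Fin n → ℝ} (hx : x ∈ Star n) : 0 ≤ size x := by
  rw [size_apply hx]; exact (hx.1 _).1

theorem size_le_one {x : Fin n → ℝ} (hx : x ∈ Star n) : size x ≤ 1 := by
  rw [size_apply hx]; exact (hx.1 _).2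

theorem size_of_ne_zero {x : Fin n → ℝ} (hx : x ∈ Star n) {i : Fin n} (hi : x i ≠ 0) :
    legOf x = i ∧ size x = x i := by
  have h : i = legOf x := by
    by_contra hne
    rw [eq_single hx, Pi.single_eq_of_ne hne] at hi
    exact hi rfl
  rw [← h]
  exact ⟨rfl, by rw [size_apply hx, ← h]⟩

theorem abs_size_sub_le {x y : Fin n → ℝ} (hx : x ∈ Star n) (hy : y ∈ Star n) :
    |size x - size y| ≤ dist x y := by
  have key : ∀ {x y : Fin n → ℝ}, x ∈ Star n → y ∈ Star n → size x - size y ≤ dist x y := by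
    intro x y hx hy
    have h1 := dist_le_pi_dist x y (legOf x)
    rw [Real.dist_eq] at h1
    have h2 : y (legOf x) ≤ size y := by
      by_cases h : y (legOf x) = 0
      · rw [h]; exact size_nonneg hy
      · exact (size_of_ne_zero hy h).2.ge
    have h3 := (abs_le.1 h1).2
    rw [size_apply hx]; linarith
  rw [abs_le]
  have h1 := key hx hy
  have h2 := key hy hx
  rw [dist_comm] at h2
  constructor <;> linarith

theorem size_le_dist {x y : Fin n → ℝ} (hx : x ∈ Star n) (hy : y ∈ Star n)
    (h : legOf x ≠ legOf y) : size x ≤ dist x y ∧ size y ≤ dist x y := by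
  have key : ∀ {x y : Fin n → ℝ}, x ∈ Star n → y ∈ Star n → legOf x ≠ legOf y →
      size x ≤ dist x y := by
    intro x y hx hy h
    have h1 := dist_le_pi_dist x y (legOf x)
    have h0 : y (legOf x) = 0 := by
      by_contra h'
      exact h (size_of_ne_zero hy h').1.symm
    rw [h0, Real.dist_eq, sub_zero, ← size_apply hx, abs_of_nonneg (size_nonneg hx)] at h1
    exact h1
  exact ⟨key hx hy h, by rw [dist_comm]; exact key hy hx (Ne.symm h)⟩

theorem dist_le_of_size_le {x y : Fin n → ℝ} (hx : x ∈ Star n) (hy : y ∈ Star n) {c : ℝ}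
    (h1 : size x ≤ c) (h2 : size y ≤ c) : dist x y ≤ c := by
  have hc : 0 ≤ c := (size_nonneg hx).trans h1
  have key : ∀ {x : Fin n → ℝ}, x ∈ Star n → ∀ i, x i ≤ size x := by
    intro x hx i
    by_cases h : x i = 0
    · rw [h]; exact size_nonneg hx
    · exact (size_of_ne_zero hx h).2.ge
  refine (dist_pi_le_iff hc).2 fun i => ?_
  rw [Real.dist_eq, abs_le]
  have a1 := key hx i
  have a2 := key hy i
  have a3 := (hx.1 i).1
  have a4 := (hy.1 i).1
  constructor <;> linarith

variable {W : ℕ}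

theorem fold_single (i : Fin n) {t : ℝ} (ht : t ≤ 1) {s : ℕ} (h1 : s ≤ W * t)
    (h2 : W * t ≤ s + 1) :
    fold n W (Pi.single i t) =
      Pi.single (Fin.ofNat n s) (height n i s * bump (W * t - s)) := by
  have hsW : s ≤ W := by
    have : (s : ℝ) ≤ W := h1.trans (mul_le_of_le_one_right (Nat.cast_nonneg _) ht)
    exact_mod_cast this
  ext j
  unfold fold
  rw [Finset.sum_eq_single i, Finset.sum_eq_single s]
  · by_cases hj : j = Fin.ofNat n s
    · subst hj; simp
    · rw [Pi.single_eq_of_ne hj, if_neg]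
      intro h; exact hj (Fin.ext (by simpa using h.symm))
  · intro s' _ hs
    rw [Pi.single_eq_same, bump_eq_zero, mul_zero, ite_self]
    rcases lt_or_gt_of_ne hs with h | h
    · right
      have : (s' : ℝ) + 1 ≤ s := by exact_mod_cast h
      linarith
    · left
      have : (s : ℝ) + 1 ≤ s' := by exact_mod_cast h
      linarith
  · intro h; exact absurd (Finset.mem_range.2 (by omega)) h
  · intro i' _ hi
    refine Finset.sum_eq_zero fun s' _ => ?_
    rw [Pi.single_eq_of_ne hi, bump_eq_zero (Or.inl (by simp)), mul_zero, ite_self]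
  · simp

theorem fold_eq {x : Fin n → ℝ} (hx : x ∈ Star n) :
    fold n W x = Pi.single (Fin.ofNat n ⌊W * size x⌋₊)
      (height n (legOf x) ⌊W * size x⌋₊ * bump (W * size x - ⌊W * size x⌋₊)) := by
  conv_lhs => rw [eq_single hx]
  exact fold_single _ (size_le_one hx)
    (Nat.floor_le (mul_nonneg (Nat.cast_nonneg _) (size_nonneg hx))) (Nat.lt_floor_add_one _).le

theorem fold_mem {x : Fin n → ℝ} (hx : x ∈ Star n) : fold n W x ∈ Star n := by
  rw [fold_eq hx]
  have h1 := half_le_height n (legOf x) ⌊W * size x⌋₊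
  refine single_mem_Star (mul_nonneg (by linarith) (bump_nonneg _))
    (mul_le_one₀ (height_le_one _ _ _) (bump_nonneg _) (bump_le_one _))

theorem fold_zero : fold n W 0 = 0 := by
  rw [← Pi.single_zero (0 : Fin n), fold_single (s := 0) 0 zero_le_one (by simp) (by simp)]
  simp [bump_eq_zero]

theorem exists_fold_eq (hW : 2 * n ^ 2 ≤ W) (i : Fin n) {y : Fin n → ℝ} (hy : y ∈ Star n) :
    ∃ t : ℝ, 0 ≤ t ∧ t ≤ 1 / 2 ∧ fold n W (Pi.single i t) = y := by
  have h0 := size_nonneg hy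
  have h1 := size_le_one hy
  have hn : 0 < n := Nat.pos_of_ne_zero (NeZero.ne n)
  have hW0 : (0 : ℝ) < W := by
    have : 0 < W := lt_of_lt_of_le (by positivity) hW
    exact_mod_cast this
  obtain ⟨s, hs⟩ : ∃ s, s = n * (i : ℕ) + legOf y := ⟨_, rfl⟩
  have hsn : s + 1 ≤ n ^ 2 := by
    have := (legOf y).2
    have : (i : ℕ) + 1 ≤ n := i.2
    nlinarith
  have hsW : 2 * ((s : ℝ) + 1) ≤ W := by exact_mod_cast (by omega : 2 * (s + 1) ≤ W)
  have hWt : (W : ℝ) * ((s + size y / 2) / W) = s + size y / 2 := by field_simp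
  have ht : (s + size y / 2) / W ≤ 1 / 2 := by
    rw [div_le_iff₀ hW0]; linarith
  refine ⟨(s + size y / 2) / W, by positivity, ht, ?_⟩
  rw [fold_single (s := s) i (by linarith) (by rw [hWt]; linarith) (by rw [hWt]; linarith), hWt,
    add_sub_cancel_left, bump_of_le (by linarith) (by linarith)]
  have hheight : height n i s = 1 := by
    unfold height
    rw [if_pos]
    rw [hs, Nat.mul_add_div hn, Nat.div_eq_of_lt (legOf y).2, add_zero, Nat.mod_eq_of_lt i.2]
  have hleg : Fin.ofNat n s = legOf y := by
    apply Fin.ext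
    simp [hs, Nat.mod_eq_of_lt (legOf y).2]
  rw [hheight, hleg, one_mul]
  conv_rhs => rw [eq_single hy]
  congr 1; ring

theorem fold_natCast (hW : 0 < W) (i : Fin n) {k : ℕ} (hk : k ≤ W) :
    fold n W (Pi.single i ((k : ℝ) / W)) = 0 := by
  have hW0 : (0 : ℝ) < W := by exact_mod_cast hW
  have e : (W : ℝ) * (k / W) = k := by field_simp
  rw [fold_single (s := k) i ((div_le_one hW0).2 (by exact_mod_cast hk)) e.ge (by linarith), e,
    sub_self, bump_eq_zero (Or.inl le_rfl), mul_zero, Pi.single_zero]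

theorem fold_fold_lattice (hW : 0 < W) (i : Fin n) {k : ℕ} (hk : k ≤ 2 * (2 * W)) :
    fold n (2 * W) (fold n (2 * W) (Pi.single i ((k : ℝ) / (2 * (2 * W : ℕ) : ℕ)))) = 0 := by
  have hW0 : (0 : ℝ) < W := by exact_mod_cast hW
  rcases Nat.even_or_odd' k with ⟨s, rfl | rfl⟩
  · have e : ((2 * s : ℕ) : ℝ) / (2 * (2 * W : ℕ) : ℕ) = (s : ℝ) / (2 * W : ℕ) := by
      push_cast; field_simp
    rw [e, fold_natCast (by omega) i (by omega), fold_zero]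
  · have e : ((2 * W : ℕ) : ℝ) * (((2 * s + 1 : ℕ) : ℝ) / (2 * (2 * W : ℕ) : ℕ)) = s + 1 / 2 := by
      push_cast; field_simp
    have hle : ((2 * s + 1 : ℕ) : ℝ) / (2 * (2 * W : ℕ) : ℕ) ≤ 1 := by
      rw [div_le_one (by positivity)]; exact_mod_cast hk
    rw [fold_single (s := s) i hle (by rw [e]; linarith) (by rw [e]; linarith), e,
      add_sub_cancel_left, bump_of_le (by norm_num) le_rfl]
    unfold height
    split_ifs
    · have := fold_natCast (n := n) (W := 2 * W) (by omega) (Fin.ofNat n s) (k := 2 * W) le_rfl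
      rw [div_self (by positivity)] at this
      convert this using 3; norm_num
    · have := fold_natCast (n := n) (W := 2 * W) (by omega) (Fin.ofNat n s) (k := W) (by omega)
      convert this using 3
      push_cast; field_simp

theorem fold_injOn_lap (i : Fin n) {k : ℕ} {t t' : ℝ} (h1 : k ≤ 2 * W * t) (h2 : 2 * W * t ≤ k + 1)
    (h1' : k ≤ 2 * W * t') (h2' : 2 * W * t' ≤ k + 1) (ht : t ≤ 1) (ht' : t' ≤ 1) (hW : 0 < W)
    (h : fold n W (Pi.single i t) = fold n W (Pi.single i t')) : t = t' := by
  have hW0 : (0 : ℝ) < W := by exact_mod_cast hW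
  obtain ⟨s, hs⟩ : ∃ s, s = k / 2 := ⟨_, rfl⟩
  have hh := half_le_height n i s
  have hne : height n i s ≠ 0 := by linarith
  have k0 : 2 * (s : ℝ) ≤ k := by exact_mod_cast (by omega : 2 * s ≤ k)
  have k1 : (k : ℝ) ≤ 2 * s + 1 := by exact_mod_cast (by omega : k ≤ 2 * s + 1)
  rw [fold_single (s := s) i ht (by linarith) (by linarith),
    fold_single (s := s) i ht' (by linarith) (by linarith)] at h
  have hb := mul_left_cancel₀ hne (Pi.single_injective _ h)
  have : W * t = W * t' := by
    rcases Nat.even_or_odd' k with ⟨s', hk | hk⟩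
    · obtain rfl : s' = s := by omega
      have : (k : ℝ) = 2 * s' := by exact_mod_cast hk
      rw [bump_of_le (by linarith) (by linarith), bump_of_le (by linarith) (by linarith)] at hb
      linarith
    · obtain rfl : s' = s := by omega
      have : (k : ℝ) = 2 * s' + 1 := by exact_mod_cast hk
      rw [bump_of_ge (by linarith) (by linarith), bump_of_ge (by linarith) (by linarith)] at hb
      linarith
  exact mul_left_cancel₀ hW0.ne' this

theorem exists_fold_lap (hW : 0 < W) (i : Fin n) {k : ℕ} (hk : k + 1 ≤ 2 * W) :
    ∃ j : Fin n, ∀ c : ℝ, 0 ≤ c → c ≤ 1 / 2 → ∃ t : ℝ, (k : ℝ) / (2 * W) ≤ t ∧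
      t ≤ ((k : ℝ) + 1) / (2 * W) ∧ fold n W (Pi.single i t) = Pi.single j c := by
  have hW0 : (0 : ℝ) < W := by exact_mod_cast hW
  obtain ⟨s, hs⟩ : ∃ s, s = k / 2 := ⟨_, rfl⟩
  refine ⟨Fin.ofNat n s, fun c hc0 hc1 => ?_⟩
  have hh := half_le_height n i s
  have hpos : 0 < height n i s := by linarith
  have hb0 : 0 ≤ c / height n i s := by positivity
  have hb1 : c / height n i s ≤ 1 := by rw [div_le_one hpos]; linarith
  have hc : height n i s * (c / height n i s) = c := by field_simp
  have hkW : (k : ℝ) + 1 ≤ 2 * W := by exact_mod_cast hk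
  have hle : ∀ {t : ℝ}, t ≤ ((k : ℝ) + 1) / (2 * W) → t ≤ 1 := fun ht =>
    ht.trans ((div_le_one (by positivity)).2 hkW)
  rcases Nat.even_or_odd' k with ⟨s', h | h⟩
  · obtain rfl : s' = s := by omega
    have hk' : (k : ℝ) = 2 * s' := by exact_mod_cast h
    have e : (W : ℝ) * ((s' + c / height n i s' / 2) / W) = s' + c / height n i s' / 2 := by
      field_simp
    have ht : (s' + c / height n i s' / 2) / W ≤ ((k : ℝ) + 1) / (2 * W) := by
      rw [div_le_div_iff₀ hW0 (by positivity), hk']; nlinarith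
    refine ⟨(s' + c / height n i s' / 2) / W, ?_, ht, ?_⟩
    · rw [div_le_div_iff₀ (by positivity) hW0, hk']; nlinarith
    · rw [fold_single (s := s') i (hle ht) (by rw [e]; linarith) (by rw [e]; linarith), e,
        add_sub_cancel_left, bump_of_le (by linarith) (by linarith), mul_div_cancel₀ _ two_ne_zero,
        hc]
  · obtain rfl : s' = s := by omega
    have hk' : (k : ℝ) = 2 * s' + 1 := by exact_mod_cast h
    have e : (W : ℝ) * ((s' + (1 - c / height n i s' / 2)) / W) =
        s' + (1 - c / height n i s' / 2) := by field_simp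
    have ht : (s' + (1 - c / height n i s' / 2)) / W ≤ ((k : ℝ) + 1) / (2 * W) := by
      rw [div_le_div_iff₀ hW0 (by positivity), hk']; nlinarith
    refine ⟨(s' + (1 - c / height n i s' / 2)) / W, ?_, ht, ?_⟩
    · rw [div_le_div_iff₀ (by positivity) hW0, hk']; nlinarith
    · rw [fold_single (s := s') i (hle ht) (by rw [e]; linarith) (by rw [e]; linarith), e,
        add_sub_cancel_left, bump_of_ge (by linarith) (by linarith)]
      congr 1
      rw [← hc]; field_simp; ring

end

open Set Topology

theorem isPreconnected_iInter_of_antitone {Z : Type*} [TopologicalSpace Z] [T2Space Z]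
    {s : ℕ → Set Z} (hs : Antitone s) (hc : ∀ k, IsCompact (s k))
    (hp : ∀ k, IsPreconnected (s k)) : IsPreconnected (⋂ k, s k) := by
  have hI : IsCompact (⋂ k, s k) :=
    (hc 0).of_isClosed_subset (isClosed_iInter fun k => (hc k).isClosed) (iInter_subset _ _)
  rw [isPreconnected_closed_iff]
  intro t t' ht ht' hcov ⟨a, ha, hat⟩ ⟨b, hb, hbt⟩
  by_contra hne
  have hdisj : Disjoint ((⋂ k, s k) ∩ t) ((⋂ k, s k) ∩ t') := by
    rw [Set.disjoint_left]
    exact fun x hx hx' => hne ⟨x, hx.1, hx.2, hx'.2⟩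
  obtain ⟨U, V, hU, hV, htU, htV, hUV⟩ :=
    SeparatedNhds.of_isCompact_isCompact (hI.inter_right ht) (hI.inter_right ht') hdisj
  have hsub : ∀ x ∈ ⋂ k, s k, U ∪ V ∈ 𝓝 x := by
    intro x hx
    refine (hU.union hV).mem_nhds ?_
    rcases hcov hx with h | h
    · exact Or.inl (htU ⟨hx, h⟩)
    · exact Or.inr (htV ⟨hx, h⟩)
  obtain ⟨N, hN⟩ := exists_subset_nhds_of_isCompact hs.directed_ge hc hsub
  obtain ⟨x, -, hxU, hxV⟩ := hp N U V hU hV hN ⟨a, mem_iInter.1 ha N, htU ⟨ha, hat⟩⟩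
    ⟨b, mem_iInter.1 hb N, htV ⟨hb, hbt⟩⟩
  exact Set.disjoint_left.1 hUV hxU hxV

/-- `K` is the inverse limit of the sequence `Y ← Y ← Y ← ⋯` with bonding map `f`. -/
structure IsLimit {K Y : Type*} [TopologicalSpace K] [TopologicalSpace Y] (f : Y → Y)
    (π : ℕ → K → Y) : Prop where
  continuous : ∀ k, Continuous (π k)
  comp : ∀ k x, f (π (k + 1) x) = π k x
  ext : ∀ x y, (∀ k, π k x = π k y) → x = y
  exists_of_thread : ∀ z : ℕ → Y, (∀ k, f (z (k + 1)) = z k) → ∃ x, ∀ k, π k x = z k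

theorem isPreconnected_threads {Y : Type*} [TopologicalSpace Y] [CompactSpace Y] [T2Space Y]
    [PreconnectedSpace Y] {f : Y → Y} (hf : Continuous f) :
    IsPreconnected {x : ℕ → Y | ∀ k, f (x (k + 1)) = x k} := by
  have e : {x : ℕ → Y | ∀ k, f (x (k + 1)) = x k} =
      ⋂ N : ℕ, {x : ℕ → Y | ∀ k < N, f (x (k + 1)) = x k} := by
    ext x
    simp only [mem_ofPred_eq, mem_iInter]
    exact ⟨fun h N k _ => h k, fun h k => h (k + 1) k (by omega)⟩
  rw [e]
  refine isPreconnected_iInter_of_antitone (fun N M h x hx k hk => hx k (by omega))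
    (fun N => IsClosed.isCompact ?_) fun N => ?_
  · simp only [ofPred_forall]
    exact isClosed_iInter fun k => isClosed_iInter fun _ =>
      isClosed_eq (hf.comp (continuous_apply _)) (continuous_apply _)
  · have hr : {x : ℕ → Y | ∀ k < N, f (x (k + 1)) = x k} =
        range fun (y : ℕ → Y) (k : ℕ) => if k < N then f^[N - k] (y N) else y k := by
      ext x
      constructor
      · intro hx
        have key : ∀ d, d ≤ N → f^[d] (x N) = x (N - d) := by
          intro d
          induction d with
          | zero => intro _; rfl
          | succ d ih =>
            intro hd
            rw [Function.iterate_succ_apply', ih (by omega), ← hx (N - (d + 1)) (by omega)]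
            congr 2; omega
        refine ⟨x, funext fun k => ?_⟩
        dsimp only
        split_ifs with h
        · rw [key _ (by omega)]; congr 1; omega
        · rfl
      · rintro ⟨y, rfl⟩ k hk
        dsimp only
        rw [if_pos hk]
        split_ifs with h
        · rw [← Function.iterate_succ_apply' f]; congr 1; omega
        · have : k + 1 = N := by omega
          subst this; simp
    rw [hr]
    refine isPreconnected_range (continuous_pi fun k => ?_)
    split_ifs
    · exact (hf.iterate _).comp (continuous_apply _)
    · exact continuous_apply _

theorem exists_limit {Y : Type} [MetricSpace Y] [CompactSpace Y] [PreconnectedSpace Y] {f : Y → Y}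
    (hf : Continuous f) : ∃ (K : Type) (_ : MetricSpace K) (π : ℕ → K → Y), CompactSpace K ∧
      PreconnectedSpace K ∧ IsLimit f π := by
  let s : Set (ℕ → Y) := {x | ∀ k, f (x (k + 1)) = x k}
  have hs : IsClosed s := by
    simp only [s, ofPred_forall]
    exact isClosed_iInter fun k =>
      isClosed_eq (hf.comp (continuous_apply _)) (continuous_apply _)
  have h1 : CompactSpace s := isCompact_iff_compactSpace.1 hs.isCompact
  have h2 : PreconnectedSpace s := isPreconnected_iff_preconnectedSpace.1 (isPreconnected_threads hf)
  have h3 : IsLimit f (fun k (x : s) => x.1 k) :=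
    { continuous := fun k => (continuous_apply k).comp continuous_subtype_val
      comp := fun k x => x.2 k
      ext := fun x y h => Subtype.ext (funext h)
      exists_of_thread := fun z hz => ⟨⟨z, hz⟩, fun _ => rfl⟩ }
  exact ⟨s, TopologicalSpace.metrizableSpaceMetric s, _, h1, h2, h3⟩

namespace IsLimit

variable {K Y : Type*} [MetricSpace K] [MetricSpace Y] {f : Y → Y} {π : ℕ → K → Y}

theorem iterate (hπ : IsLimit f π) (k d : ℕ) (x : K) : f^[d] (π (k + d) x) = π k x := by
  induction d with
  | zero => rfl
  | succ d ih => rw [Function.iterate_succ_apply, ← add_assoc, hπ.comp, ih]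

theorem eq_of_le (hπ : IsLimit f π) {k N : ℕ} (h : k ≤ N) {x y : K} (hxy : π N x = π N y) :
    π k x = π k y := by
  obtain ⟨d, rfl⟩ := Nat.exists_eq_add_of_le h
  rw [← hπ.iterate k d x, ← hπ.iterate k d y, hxy]

theorem surjective (hπ : IsLimit f π) (hf : Function.Surjective f) (N : ℕ) :
    Function.Surjective (π N) := by
  intro a
  obtain ⟨σ, hσ⟩ := hf.hasRightInverse
  obtain ⟨x, hx⟩ := hπ.exists_of_thread
    (fun k => if k ≤ N then f^[N - k] a else σ^[k - N] a) (fun k => by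
      rcases lt_trichotomy k N with h | rfl | h
      · rw [if_pos (by omega), if_pos h.le, ← Function.iterate_succ_apply' f]
        congr 1; omega
      · rw [if_neg (by omega), if_pos le_rfl]
        simp [hσ a]
      · rw [if_neg (by omega), if_neg (by omega), show k + 1 - N = (k - N) + 1 by omega,
          Function.iterate_succ_apply', hσ])
  exact ⟨x, by rw [hx N, if_pos le_rfl, Nat.sub_self]; rfl⟩

theorem exists_uniform [CompactSpace K] (hπ : IsLimit f π) {Z : Type*} [MetricSpace Z]
    {φ : K → Z} (hφ : Continuous φ) {ε : ℝ} (hε : 0 < ε) :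
    ∃ N, ∃ δ > 0, ∀ x y, dist (π N x) (π N y) < δ → dist (φ x) (φ y) < ε := by
  let Q : Set (K × K) := {p | ε ≤ dist (φ p.1) (φ p.2)}
  have hQ : IsCompact Q := (isClosed_le continuous_const (by fun_prop)).isCompact
  have hd : ∀ N, Continuous fun p : K × K => dist (π N p.1) (π N p.2) := fun N =>
    ((hπ.continuous N).comp continuous_fst).dist ((hπ.continuous N).comp continuous_snd)
  obtain ⟨N, hN⟩ := hQ.elim_directed_cover (fun N => {p : K × K | 0 < dist (π N p.1) (π N p.2)})
    (fun N => isOpen_lt continuous_const (hd N))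
    (by
      intro p hp
      by_contra hcon
      simp only [mem_iUnion, mem_ofPred_eq, not_exists, dist_pos, not_not] at hcon
      have : p.1 = p.2 := hπ.ext _ _ hcon
      simp only [Q, mem_ofPred_eq, this, dist_self] at hp
      linarith)
    (directed_of_isDirected_le fun k N h p hp => by
      simp only [mem_ofPred_eq, dist_pos] at hp ⊢
      exact fun he => hp (hπ.eq_of_le h he))
  obtain ⟨δ, hδ, hmin⟩ := hQ.exists_forall_le' (hd N).continuousOn (a := 0) fun p hp => hN hp
  refine ⟨N, δ, hδ, fun x y hxy => ?_⟩
  by_contra hcon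
  exact absurd (hmin (x, y) (not_lt.1 hcon)) (not_le.2 hxy)

end IsLimit

theorem exists_homeomorph_Icc {K : Type*} [TopologicalSpace K] {A : Set K}
    (hA : IsCompact A) (hA' : IsConnected A) (hnt : A.Nontrivial) {ψ : K → ℝ} (hψ : Continuous ψ)
    (hinj : InjOn ψ A) : ∃ e : ↥(Icc (0 : ℝ) 1) ≃ₜ ↥A, ∀ p ∈ A, (∀ x ∈ A, ψ p ≤ ψ x) →
      ((e ⟨0, left_mem_Icc.mpr zero_le_one⟩ : ↥A) : K) = p := by
  have himg := eq_Icc_of_connected_compact (hA'.image ψ hψ.continuousOn) (hA.image hψ)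
  set a := sInf (ψ '' A) with ha
  set b := sSup (ψ '' A) with hb
  clear_value a b
  obtain ⟨x, hx, y, hy, hxy⟩ := hnt
  have hmem : ∀ z ∈ A, ψ z ∈ Icc a b := fun z hz => by
    rw [← himg]; exact mem_image_of_mem ψ hz
  have hab : a < b := by
    refine lt_of_le_of_ne ((hmem x hx).1.trans (hmem x hx).2) fun h => hxy (hinj hx hy ?_)
    have h1 := hmem x hx
    have h2 := hmem y hy
    exact le_antisymm (by linarith [h1.2, h2.1]) (by linarith [h1.1, h2.2])
  have : CompactSpace A := isCompact_iff_compactSpace.1 hA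
  let g : A → Icc a b := fun z => ⟨ψ z, hmem z z.2⟩
  have hg : Continuous g := (hψ.comp continuous_subtype_val).subtype_mk _
  have hbij : Function.Bijective g := by
    refine ⟨fun z w h => Subtype.ext (hinj z.2 w.2 (congrArg Subtype.val h)), fun c => ?_⟩
    have : (c : ℝ) ∈ ψ '' A := by rw [himg]; exact c.2
    obtain ⟨z, hz, hzc⟩ := this
    exact ⟨⟨z, hz⟩, Subtype.ext hzc⟩
  let G : A ≃ₜ Icc a b := Continuous.homeoOfEquivCompactToT2 (f := Equiv.ofBijective g hbij) hg
  refine ⟨((iccHomeoI a b hab).symm.trans G.symm), fun p hp hmin => ?_⟩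
  have h1 : G ⟨p, hp⟩ = (iccHomeoI a b hab).symm ⟨0, left_mem_Icc.mpr zero_le_one⟩ := by
    apply Subtype.ext
    rw [iccHomeoI_symm_apply_coe]
    change ψ p = _
    have : a ∈ ψ '' A := by rw [himg]; exact left_mem_Icc.2 hab.le
    obtain ⟨z, hz, hza⟩ := this
    have := hmin z hz
    have := (hmem p hp).1
    simp only [mul_zero, zero_add]
    linarith
  rw [Homeomorph.trans_apply, ← h1, Homeomorph.symm_apply_apply]

variable {n : ℕ}

theorem isCompact_Star : IsCompact (Star n) := by
  refine (isCompact_univ_pi fun _ : Fin n => isCompact_Icc (a := (0 : ℝ)) (b := 1)).of_isClosed_subset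
    ?_ fun x hx i _ => hx.1 i
  have : Star n = (⋂ i, {x : Fin n → ℝ | 0 ≤ x i ∧ x i ≤ 1}) ∩
      ⋂ i, ⋂ j, ⋂ (_ : i ≠ j), {x : Fin n → ℝ | x i = 0 ∨ x j = 0} := by
    ext x; simp [Star]
  rw [this]
  refine (isClosed_iInter fun i => ?_).inter
    (isClosed_iInter fun i => isClosed_iInter fun j => isClosed_iInter fun _ => ?_)
  · exact (isClosed_le continuous_const (continuous_apply i)).inter
      (isClosed_le (continuous_apply i) continuous_const)
  · exact (isClosed_eq (continuous_apply i) continuous_const).union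
      (isClosed_eq (continuous_apply j) continuous_const)

instance : CompactSpace (Star n) := isCompact_iff_compactSpace.1 isCompact_Star

variable [NeZero n]

instance : PreconnectedSpace (Star n) := by
  refine isPreconnected_iff_preconnectedSpace.1 (isPreconnected_of_forall 0 fun y hy => ?_)
  refine ⟨(fun c : ℝ => (Pi.single (legOf y) c : Fin n → ℝ)) '' Icc 0 1, ?_, ⟨0, by simp, by simp⟩,
    ⟨size y, ⟨size_nonneg hy, size_le_one hy⟩, (eq_single hy).symm⟩, ?_⟩
  · rintro _ ⟨c, hc, rfl⟩
    exact single_mem_Star hc.1 hc.2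
  · exact isPreconnected_Icc.image _ (continuous_single (A := fun _ => ℝ) (legOf y)).continuousOn

/-- The folding map as a self-map of the star. -/
noncomputable def starMap (n W : ℕ) [NeZero n] (x : Star n) : Star n := ⟨fold n W x, fold_mem x.2⟩

theorem continuous_starMap (W : ℕ) : Continuous (starMap n W) :=
  ((continuous_fold n W).comp continuous_subtype_val).subtype_mk _

theorem surjective_starMap {W : ℕ} (hW : 2 * n ^ 2 ≤ W) : Function.Surjective (starMap n W) := by
  intro y
  obtain ⟨t, h0, h1, h⟩ := exists_fold_eq hW 0 y.2
  exact ⟨⟨_, single_mem_Star h0 (by linarith)⟩, Subtype.ext h⟩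

section Subcontinua

variable {K : Type*} [MetricSpace K] {W : ℕ} {π : ℕ → K → Star n}

theorem proj_comp (hπ : IsLimit (starMap n W) π) (k : ℕ) (x : K) :
    fold n W (π (k + 1) x) = π k x := congrArg Subtype.val (hπ.comp k x)

theorem injOn_size_proj (hπ : IsLimit (starMap n W) π) {A : Set K} {N : ℕ}
    (h1 : ∀ x ∈ A, ∀ y ∈ A, size (π N x : Fin n → ℝ) = size (π N y : Fin n → ℝ) → π N x = π N y)
    (h2 : ∀ k, N ≤ k → ∀ x ∈ A, ∀ y ∈ A, π k x = π k y → π (k + 1) x = π (k + 1) y) :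
    InjOn (fun x => size (π N x : Fin n → ℝ)) A := by
  intro x hx y hy hxy
  have h3 : π N x = π N y := h1 x hx y hy hxy
  have key : ∀ k, N ≤ k → π k x = π k y := by
    intro k hk
    induction k, hk using Nat.le_induction with
    | base => exact h3
    | succ k hk ih => exact h2 k hk x hx y hy ih
  refine hπ.ext _ _ fun k => ?_
  rcases le_total N k with h | h
  · exact key k h
  · exact hπ.eq_of_le h h3

theorem proj_succ_eq_of_lap (hπ : IsLimit (starMap n W) π) (hW : 0 < W) {k j : ℕ} {x y : K}
    {i : Fin n} {t t' : ℝ} (hx : (π (k + 1) x : Fin n → ℝ) = Pi.single i t)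
    (hy : (π (k + 1) y : Fin n → ℝ) = Pi.single i t') (ht : t ≤ 1) (ht' : t' ≤ 1)
    (h1 : j ≤ 2 * W * t) (h2 : 2 * W * t ≤ j + 1) (h3 : j ≤ 2 * W * t') (h4 : 2 * W * t' ≤ j + 1)
    (h : π k x = π k y) : π (k + 1) x = π (k + 1) y := by
  have h5 := proj_comp hπ k x
  rw [h, ← proj_comp hπ k y, hx, hy] at h5
  apply Subtype.ext
  rw [hx, hy, fold_injOn_lap _ h1 h2 h3 h4 ht ht' hW h5]

theorem exists_proj_eq_single (hπ : IsLimit (starMap n W) π) {A : Set K} (hA : IsConnected A)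
    {k : ℕ} {x y : K} (hx : x ∈ A) (hy : y ∈ A) {i : Fin n} {t : ℝ} (ht : 0 < t)
    (h1 : (π k x : Fin n → ℝ) i ≤ t) (h2 : t ≤ (π k y : Fin n → ℝ) i) :
    ∃ z ∈ A, (π k z : Fin n → ℝ) = Pi.single i t := by
  have hc : Continuous fun z => (π k z : Fin n → ℝ) i :=
    (continuous_apply i).comp (continuous_subtype_val.comp (hπ.continuous k))
  obtain ⟨z, hz, hzt⟩ := hA.isPreconnected.intermediate_value hx hy hc.continuousOn ⟨h1, h2⟩
  obtain ⟨h3, h4⟩ := size_of_ne_zero (π k z).2 (i := i) (by simpa [hzt] using ht.ne')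
  refine ⟨z, hz, ?_⟩
  rw [eq_single (π k z).2, h3, h4]
  exact congrArg _ hzt

theorem legOf_proj_eq (hπ : IsLimit (starMap n W) π) {A : Set K} (hA : IsConnected A)
    {k : ℕ} (h0 : ∀ z ∈ A, (π k z : Fin n → ℝ) ≠ 0) {x y : K} (hx : x ∈ A) (hy : y ∈ A) :
    legOf (π k x : Fin n → ℝ) = legOf (π k y : Fin n → ℝ) := by
  by_contra hne
  have hpos : ∀ z ∈ A, 0 < size (π k z : Fin n → ℝ) := fun z hz => by
    refine lt_of_le_of_ne (size_nonneg (π k z).2) fun h => h0 z hz ?_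
    rw [eq_single (π k z).2, ← h, Pi.single_zero]
  obtain ⟨i, hi⟩ : ∃ i, i = legOf (π k x : Fin n → ℝ) := ⟨_, rfl⟩
  have hxi : (π k x : Fin n → ℝ) i = size (π k x : Fin n → ℝ) := by
    rw [size_apply (π k x).2, hi]
  have hyi : (π k y : Fin n → ℝ) i = 0 := by
    by_contra h
    exact hne (hi.symm.trans (size_of_ne_zero (π k y).2 h).1.symm)
  have hq : Continuous fun z => (π k z : Fin n → ℝ) :=
    continuous_subtype_val.comp (hπ.continuous k)
  have hc : Continuous fun z => 2 * (π k z : Fin n → ℝ) i - size (π k z : Fin n → ℝ) :=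
    (continuous_const.mul ((continuous_apply i).comp hq)).sub (continuous_size.comp hq)
  have hx0 := hpos x hx
  have hy0 := hpos y hy
  obtain ⟨z, hz, hz0⟩ := hA.isPreconnected.intermediate_value hy hx hc.continuousOn
    (show (0 : ℝ) ∈ Icc _ _ by
      constructor
      · rw [hyi]; linarith
      · rw [hxi]; linarith)
  dsimp only at hz0
  have hz1 := hpos z hz
  by_cases h : (π k z : Fin n → ℝ) i = 0
  · rw [h] at hz0; linarith
  · rw [(size_of_ne_zero (π k z).2 h).2] at hz0 hz1; linarith

theorem proj_eq_zero_of_le (hπ : IsLimit (starMap n W) π) {j k : ℕ} (hjk : j ≤ k) {z : K}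
    (h : (π k z : Fin n → ℝ) = 0) : (π j z : Fin n → ℝ) = 0 := by
  induction k, hjk using Nat.le_induction with
  | base => exact h
  | succ k hk ih => exact ih (by rw [← proj_comp hπ, h, fold_zero])

theorem eq_univ_of_halfLegs [CompactSpace K] (hπ : IsLimit (starMap n W) π) (hW : 2 * n ^ 2 ≤ W)
    {A : Set K} (hA : IsCompact A)
    (h : ∀ N, ∃ k, N ≤ k ∧ ∃ i, ∀ t : ℝ, 0 ≤ t → t ≤ 1 / 2 →
      ∃ z ∈ A, (π k z : Fin n → ℝ) = Pi.single i t) : A = univ := by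
  refine eq_univ_of_forall fun x => ?_
  rw [← hA.isClosed.closure_eq, Metric.mem_closure_iff]
  intro ε hε
  obtain ⟨N, δ, hδ, hN⟩ := hπ.exists_uniform continuous_id hε
  obtain ⟨k, hk, i, hi⟩ := h (N + 1)
  obtain ⟨k, rfl⟩ : ∃ l, k = l + 1 := ⟨k - 1, by omega⟩
  obtain ⟨t, h0, h1, ht⟩ := exists_fold_eq hW i (π k x).2
  obtain ⟨z, hz, hzt⟩ := hi t h0 h1
  have h2 : π k z = π k x := Subtype.ext (by rw [← proj_comp hπ, hzt, ht])
  refine ⟨z, hz, hN x z ?_⟩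
  rw [hπ.eq_of_le (by omega : N ≤ k) h2, dist_self]
  exact hδ

theorem exists_injOn_of_zero_mem [CompactSpace K] (hπ : IsLimit (starMap n W) π)
    (hW : 2 * n ^ 2 ≤ W) {A : Set K} (hA : IsCompact A) (hA' : IsConnected A) (hne : A ≠ univ)
    (h0 : ∀ k, ∃ z ∈ A, (π k z : Fin n → ℝ) = 0) :
    ∃ N, InjOn (fun x => size (π N x : Fin n → ℝ)) A := by
  have hW0 : 0 < W := lt_of_lt_of_le (by have := NeZero.pos n; positivity) hW
  have hW1 : (0 : ℝ) < W := by exact_mod_cast hW0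
  have h1 : ∃ N, ∀ k, N ≤ k → ∀ i, ∃ t : ℝ, 0 ≤ t ∧ t ≤ 1 / 2 ∧
      ∀ z ∈ A, (π k z : Fin n → ℝ) ≠ Pi.single i t := by
    by_contra hcon
    push Not at hcon
    exact hne (eq_univ_of_halfLegs hπ hW hA hcon)
  obtain ⟨N, hN⟩ := h1
  have small : ∀ k, N + 1 ≤ k → ∀ x ∈ A, 2 * W * size (π k x : Fin n → ℝ) < 1 := by
    intro k hk x hx
    by_contra hcon
    obtain ⟨k, rfl⟩ : ∃ l, k = l + 1 := ⟨k - 1, by omega⟩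
    obtain ⟨j, hj⟩ := exists_fold_lap (n := n) hW0 (legOf (π (k + 1) x : Fin n → ℝ)) (k := 0)
      (by omega)
    obtain ⟨c, hc0, hc1, hc⟩ := hN k (by omega) j
    obtain ⟨t, ht0, ht1, ht⟩ := hj c hc0 hc1
    simp only [Nat.cast_zero, zero_div, zero_add] at ht0 ht1
    have : ∃ z ∈ A, (π (k + 1) z : Fin n → ℝ) =
        Pi.single (legOf (π (k + 1) x : Fin n → ℝ)) t := by
      obtain ⟨z, hz, hz0⟩ := h0 (k + 1)
      rcases ht0.eq_or_lt with rfl | ht0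
      · exact ⟨z, hz, by rw [hz0, Pi.single_zero]⟩
      · refine exists_proj_eq_single hπ hA' hz hx ht0 (by rw [hz0]; exact ht0.le) ?_
        rw [← size_apply (π (k + 1) x).2]
        refine ht1.trans ?_
        rw [div_le_iff₀ (by positivity)]; linarith
    obtain ⟨z, hz, hzt⟩ := this
    exact hc z hz (by rw [← proj_comp hπ, hzt, ht])
  have leg0 : ∀ k, N + 1 ≤ k → ∀ x ∈ A, (π k x : Fin n → ℝ) =
      Pi.single 0 (size (π k x : Fin n → ℝ)) := by
    intro k hk x hx
    have h2 := small (k + 1) (by omega) x hx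
    have h3 := size_nonneg (π (k + 1) x).2
    have h4 := proj_comp hπ k x
    rw [eq_single (π (k + 1) x).2, fold_single (s := 0) _ (size_le_one (π (k + 1) x).2)
      (by simp only [Nat.cast_zero]; positivity)
      (by simp only [Nat.cast_zero]; linarith)] at h4
    have h5 := congrArg size h4
    rw [size_single] at h5
    rw [← h5, ← h4]
    rfl
  refine ⟨N + 1, injOn_size_proj hπ (fun x hx y hy h => ?_) fun k hk x hx y hy h => ?_⟩
  · apply Subtype.ext
    rw [leg0 _ le_rfl x hx, leg0 _ le_rfl y hy, h]
  · have h2 := small (k + 1) (by omega) x hx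
    have h3 := small (k + 1) (by omega) y hy
    have h4 := size_nonneg (π (k + 1) x).2
    have h5 := size_nonneg (π (k + 1) y).2
    exact proj_succ_eq_of_lap hπ hW0 (j := 0) (leg0 (k + 1) (by omega) x hx)
      (leg0 (k + 1) (by omega) y hy) (size_le_one (π (k + 1) x).2) (size_le_one (π (k + 1) y).2)
      (by simp only [Nat.cast_zero]; positivity) (by simp only [Nat.cast_zero]; linarith)
      (by simp only [Nat.cast_zero]; positivity) (by simp only [Nat.cast_zero]; linarith) h

theorem exists_injOn_of_zero_not_mem (hW : 0 < W) (hπ : IsLimit (starMap n (2 * W)) π) {A : Set K}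
    (hA : IsConnected A) {j : ℕ} (h0 : ∀ z ∈ A, (π j z : Fin n → ℝ) ≠ 0) :
    ∃ N, InjOn (fun x => size (π N x : Fin n → ℝ)) A := by
  have hk0 : ∀ k, j ≤ k → ∀ z ∈ A, (π k z : Fin n → ℝ) ≠ 0 := fun k hk z hz h =>
    h0 z hz (proj_eq_zero_of_le hπ hk h)
  have hlat : ∀ k, j ≤ k → ∀ l : ℕ, l ≤ 2 * (2 * W) → ∀ i, ∀ z ∈ A,
      (π (k + 2) z : Fin n → ℝ) ≠ Pi.single i ((l : ℝ) / (2 * (2 * W : ℕ) : ℕ)) := by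
    intro k hk l hl i z hz h
    apply hk0 k hk z hz
    rw [← proj_comp hπ k z, ← proj_comp hπ (k + 1) z, h, fold_fold_lattice hW i hl]
  refine ⟨j + 2, injOn_size_proj hπ (fun x hx y hy h => ?_) fun k hk x hx y hy h => ?_⟩
  · apply Subtype.ext
    rw [eq_single (π _ x).2, eq_single (π _ y).2,
      legOf_proj_eq hπ hA (hk0 _ (by omega)) hx hy, h]
  · obtain ⟨k, rfl⟩ : ∃ l, k = l + 1 := ⟨k - 1, by omega⟩
    wlog hle : size (π (k + 1 + 1) x : Fin n → ℝ) ≤ size (π (k + 1 + 1) y : Fin n → ℝ)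
      generalizing x y
    · exact (this y hy x hx h.symm (le_of_not_ge hle)).symm
    have hleg := legOf_proj_eq hπ hA (hk0 (k + 1 + 1) (by omega)) hx hy
    have hx1 := eq_single (π (k + 1 + 1) x).2
    have hy1 := eq_single (π (k + 1 + 1) y).2
    have hxa := size_apply (π (k + 1 + 1) x).2
    have hya := size_apply (π (k + 1 + 1) y).2
    rw [← hleg] at hy1 hya
    have hx2 := size_nonneg (π (k + 1 + 1) x).2
    have hy2 := size_le_one (π (k + 1 + 1) y).2
    set t := size (π (k + 1 + 1) x : Fin n → ℝ)
    set t' := size (π (k + 1 + 1) y : Fin n → ℝ)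
    have hW0 : (0 : ℝ) < 2 * (2 * W : ℕ) := by positivity
    have hf1 := Nat.floor_le (mul_nonneg hW0.le hx2)
    have hf2 := Nat.lt_floor_add_one (2 * ((2 * W : ℕ) : ℝ) * t)
    set l := ⌊2 * ((2 * W : ℕ) : ℝ) * t⌋₊
    have hmono : 2 * ((2 * W : ℕ) : ℝ) * t ≤ 2 * ((2 * W : ℕ) : ℝ) * t' := by gcongr
    refine proj_succ_eq_of_lap hπ (by omega) hx1 hy1 (hle.trans hy2) hy2 hf1 hf2.le
      (hf1.trans hmono) ?_ h
    by_contra hcon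
    push Not at hcon
    have hl : l + 1 ≤ 2 * (2 * W) := by
      have : ((l + 1 : ℕ) : ℝ) < (2 * (2 * W) : ℕ) := by
        push_cast at hcon ⊢
        nlinarith
      exact_mod_cast this.le
    obtain ⟨z, hz, hzt⟩ := exists_proj_eq_single hπ hA hx hy
      (k := k + 1 + 1) (i := legOf (π (k + 1 + 1) x : Fin n → ℝ))
      (t := ((l + 1 : ℕ) : ℝ) / (2 * (2 * W : ℕ) : ℕ)) (by positivity)
      (by
        rw [← hxa, le_div_iff₀ (by positivity)]
        push_cast at hf2 ⊢; linarith)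
      (by
        rw [← hya, div_le_iff₀ (by positivity)]
        push_cast at hcon ⊢; linarith)
    exact hlat k (by omega) (l + 1) hl _ z hz hzt

theorem exists_arc [CompactSpace K] {W : ℕ} (hW : 2 * n ^ 2 ≤ 2 * W)
    (hπ : IsLimit (starMap n (2 * W)) π) {A : Set K} (hA : IsCompact A) (hA' : IsConnected A)
    (hne : A ≠ univ) (hnt : A.Nontrivial) : ∃ e : ↥(Icc (0 : ℝ) 1) ≃ₜ ↥A, ∀ p ∈ A,
      (∀ k, (π k p : Fin n → ℝ) = 0) → ((e ⟨0, left_mem_Icc.mpr zero_le_one⟩ : ↥A) : K) = p := by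
  have hW0 : 0 < W := by
    have := NeZero.pos n
    have : 0 < n ^ 2 := by positivity
    omega
  obtain ⟨N, hN⟩ : ∃ N, InjOn (fun x => size (π N x : Fin n → ℝ)) A := by
    by_cases h0 : ∀ k, ∃ z ∈ A, (π k z : Fin n → ℝ) = 0
    · exact exists_injOn_of_zero_mem hπ hW hA hA' hne h0
    · push Not at h0
      obtain ⟨j, hj⟩ := h0
      exact exists_injOn_of_zero_not_mem hW0 hπ hA' hj
  obtain ⟨e, he⟩ := exists_homeomorph_Icc hA hA' hnt
    (continuous_size.comp (continuous_subtype_val.comp (hπ.continuous N))) hN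
  refine ⟨e, fun p hp h => he p hp fun x _ => ?_⟩
  simp only [Function.comp_apply]
  rw [h N, ← Pi.single_zero (0 : Fin n), size_single]
  exact size_nonneg (π N x).2

end Subcontinua

end StarContinuum

namespace StarContinuum

open Set Topology

/-- The direction of a leg of the planar star. -/
noncomputable def direction (n k : ℕ) : ℂ :=
  Complex.exp (2 * Real.pi * Complex.I * (k : ℂ) / (n : ℂ))

theorem norm_direction (n k : ℕ) : ‖direction n k‖ = 1 := by
  have : (2 * Real.pi * Complex.I * (k : ℂ) / (n : ℂ)) =
      ((2 * Real.pi * k / n : ℝ) : ℂ) * Complex.I := by push_cast; ring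
  rw [direction, this, Complex.norm_exp_ofReal_mul_I]

theorem direction_injOn {n k l : ℕ} (hk : k < n) (hl : l < n) (h : direction n k = direction n l) :
    k = l := by
  have key : ∀ j : ℕ, direction n j = Complex.exp (2 * Real.pi * Complex.I / n) ^ j := fun j => by
    rw [direction, ← Complex.exp_nat_mul]
    congr 1; ring
  rw [key, key] at h
  exact (Complex.isPrimitiveRoot_exp n (by omega)).pow_inj hk hl h

variable {n : ℕ}

/-- The `i`-th leg of the star. -/
def legSet (i : Fin n) : Set (Star n) := {x | ∃ c ∈ Icc (0 : ℝ) 1, (x : Fin n → ℝ) = Pi.single i c}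

theorem isPreconnected_legSet_union (i j : Fin n) : IsPreconnected (legSet i ∪ legSet j) := by
  have key : ∀ l : Fin n, IsPreconnected (legSet l) := fun l => by
    have h : legSet l = (fun c : Icc (0 : ℝ) 1 =>
        (⟨Pi.single l c, single_mem_Star c.2.1 c.2.2⟩ : Star n)) '' univ := by
      ext x
      constructor
      · rintro ⟨c, hc, hx⟩
        exact ⟨⟨c, hc⟩, mem_univ _, Subtype.ext hx.symm⟩
      · rintro ⟨c, -, rfl⟩
        exact ⟨c, c.2, rfl⟩
    rw [h]
    refine isPreconnected_univ.image _ (Continuous.continuousOn ?_)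
    exact ((continuous_single (A := fun _ => ℝ) l).comp continuous_subtype_val).subtype_mk _
  exact IsPreconnected.union ⟨0, zero_mem_Star⟩ ⟨0, by simp, by simp⟩ ⟨0, by simp, by simp⟩
    (key i) (key j)

/-- The endpoint of the `i`-th leg of the star. -/
def tip (i : Fin n) : Star n := ⟨Pi.single i 1, single_mem_Star zero_le_one le_rfl⟩

theorem tip_mem_legSet (i : Fin n) : tip i ∈ legSet i := ⟨1, by simp, rfl⟩

theorem one_le_dist_tip {i k : Fin n} {x : Star n} (hx : x ∈ legSet i) (hk : k ≠ i) :
    1 ≤ dist x (tip k) := by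
  obtain ⟨c, -, hc⟩ := hx
  have h1 : dist ((x : Fin n → ℝ) k) ((Pi.single k 1 : Fin n → ℝ) k) ≤ dist x (tip k) :=
    dist_le_pi_dist (x : Fin n → ℝ) (tip k : Star n) k
  rw [hc, Pi.single_eq_of_ne hk, Pi.single_eq_same] at h1
  simpa using h1

/-- A discretized map to a star with `m` legs, for which points at distance less than `δ` have
equal or adjacent labels. -/
structure IsLabel {X : Type*} [MetricSpace X] {m : ℕ} (δ : ℝ) (h : X → Fin m → ℕ) : Prop where
  support : ∀ x i j, h x i ≠ 0 → h x j ≠ 0 → i = j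
  step : ∀ x y i, dist x y < δ → h x i ≤ h y i + 1
  cross : ∀ x y i j, dist x y < δ → h x i ≠ 0 → h y j ≠ 0 → i = j
  bounded : ∃ b, ∀ x i, h x i ≤ b

theorem reflTransGen_dist_lt {X : Type*} [MetricSpace X] [PreconnectedSpace X] {δ : ℝ} (hδ : 0 < δ)
    (x y : X) : Relation.ReflTransGen (fun a b : X => dist a b < δ) x y := by
  have hclopen : IsClopen {y | Relation.ReflTransGen (fun a b : X => dist a b < δ) x y} := by
    constructor
    · refine isClosed_of_closure_subset fun z hz => ?_
      obtain ⟨w, hw, hwz⟩ := Metric.mem_closure_iff.1 hz δ hδ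
      exact hw.tail (by rwa [dist_comm])
    · refine Metric.isOpen_iff.2 fun z hz => ⟨δ, hδ, fun w hw => hz.tail ?_⟩
      rwa [dist_comm]
  exact eq_univ_iff_forall.1 (hclopen.eq_univ ⟨x, Relation.ReflTransGen.refl⟩) y

theorem IsLabel.exists_eq_single {X : Type*} [MetricSpace X] {m : ℕ} {δ : ℝ} {h : X → Fin m → ℕ}
    (hh : IsLabel δ h) (hδ : 0 < δ) {S : Set X} (hS : IsPreconnected S) {x y : X} (hx : x ∈ S)
    (hy : y ∈ S) {i : Fin m} {a : ℕ} (h1 : h x i ≤ a) (h2 : a ≤ h y i) (h3 : 0 < h y i) :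
    ∃ z ∈ S, h z = Pi.single i a := by
  have : PreconnectedSpace S := isPreconnected_iff_preconnectedSpace.1 hS
  obtain ⟨b, hb⟩ := hh.bounded
  let D : Labelling S 1 m :=
    { adj := fun u v => dist u v < δ
      adj_refl := fun u => by rwa [dist_self]
      adj_symm := fun u v huv => by rwa [dist_comm]
      chain := reflTransGen_dist_lt hδ
      θ := fun _ => 0
      leg := fun _ => 0
      h := fun u => h u
      bound := b
      θ_nonneg := fun _ => le_rfl
      leg_lt := fun _ => one_pos
      θ_step := fun _ _ _ => by norm_num
      leg_step := fun _ _ _ hne => (hne rfl).elim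
      h_support := fun u => hh.support u
      h_step := fun u v => hh.step u v
      h_cross := fun u v => hh.cross u v
      h_le := fun u => hb u
      fiber := fun u v _ hu => by norm_num [bump] at hu }
  obtain ⟨p, hp, k, hp0, hpk⟩ := D.exists_walk ⟨x, hx⟩ ⟨y, hy⟩
  obtain ⟨t, -, -, ht⟩ := Labelling.hit_up' hp (Nat.zero_le k) (i := i) (a := a)
    (by rw [hp0]; exact h1) (by rw [hpk]; exact h2) (by rw [hpk]; exact h3)
  exact ⟨p t, (p t).2, ht⟩

theorem IsLabel.false_of_injective {m : ℕ} {δ : ℝ} {h : Star n → Fin m → ℕ} (hh : IsLabel δ h)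
    (hδ : 0 < δ) (hn : 3 ≤ n) (hm : 0 < m) (hmn : m < n)
    (hinj : ∀ x y, h x = h y → dist x y < 1 / 8) : False := by
  have hcross : ∀ i j k : Fin n, k ≠ i → k ≠ j → ∀ l, h (tip k) = Pi.single l (h (tip k) l) →
      h (tip i) l ≤ h (tip k) l → h (tip k) l ≤ h (tip j) l → 0 < h (tip j) l → False := by
    intro i j k hki hkj l hk h1 h2 h3
    obtain ⟨z, hz, hzk⟩ := hh.exists_eq_single hδ (isPreconnected_legSet_union i j)
      (Or.inl (tip_mem_legSet i)) (Or.inr (tip_mem_legSet j)) h1 h2 h3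
    have h4 := hinj z (tip k) (hzk.trans hk.symm)
    rcases hz with hz | hz
    · linarith [one_le_dist_tip hz hki]
    · linarith [one_le_dist_tip hz hkj]
  have hsing : ∀ (x : Star n) (l : Fin m), h x l ≠ 0 → h x = Pi.single l (h x l) := by
    intro x l hl
    ext l'
    by_cases hll : l' = l
    · rw [hll, Pi.single_eq_same]
    · rw [Pi.single_eq_of_ne hll]
      by_contra hne
      exact hll (hh.support x _ _ hne hl)
  have hex : ∀ x : Star n, ∃ l, h x = Pi.single l (h x l) := by
    intro x
    by_cases hx : ∃ l, h x l ≠ 0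
    · obtain ⟨l, hl⟩ := hx
      exact ⟨l, hsing x l hl⟩
    · push Not at hx
      exact ⟨⟨0, hm⟩, by ext l; simp [hx]⟩
  choose q hq using fun i : Fin n => hex (tip i)
  obtain ⟨i, j, hij, hqij⟩ := Fintype.exists_ne_map_eq_of_card_lt q (by simpa using hmn)
  wlog hlt : h (tip i) (q i) ≤ h (tip j) (q i) generalizing i j
  · exact this j i hij.symm hqij.symm (by rw [← hqij]; exact (le_of_not_ge hlt))
  have hj := hq j
  rw [← hqij] at hj
  have hi := hq i
  set l := q i
  have hlt' : h (tip i) l < h (tip j) l := by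
    refine lt_of_le_of_ne hlt fun heq => ?_
    have h1 := hinj (tip i) (tip j) (by rw [hi, hj, heq])
    linarith [one_le_dist_tip (tip_mem_legSet i) hij.symm]
  obtain ⟨k, hk⟩ : ∃ k : Fin n, k ∉ ({i, j} : Finset (Fin n)) := by
    by_contra hcon
    push Not at hcon
    have h1 : (Finset.univ : Finset (Fin n)).card ≤ ({i, j} : Finset (Fin n)).card :=
      Finset.card_le_card fun x _ => hcon x
    have h2 := Finset.card_le_two (a := i) (b := j)
    rw [Finset.card_univ, Fintype.card_fin] at h1
    omega
  simp only [Finset.mem_insert, Finset.mem_singleton, not_or] at hk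
  obtain ⟨hki, hkj⟩ := hk
  rcases le_or_gt (h (tip k) l) (h (tip i) l) with h1 | h1
  · exact hcross k j i (Ne.symm hki) hij l hi h1 hlt (by omega)
  · rcases le_total (h (tip k) l) (h (tip j) l) with h2 | h2
    · exact hcross i j k hki hkj l (hsing _ _ (by omega)) h1.le h2 (by omega)
    · exact hcross i k j hij.symm (Ne.symm hkj) l hj hlt h2 (by omega)

variable [NeZero n]

theorem exists_homeomorph_simpleOdSet : Nonempty (Star n ≃ₜ simpleOdSet n) := by
  let E : (Fin n → ℝ) → ℂ := fun x => ∑ i, (x i : ℂ) * direction n i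
  have hE : Continuous E := by fun_prop
  have hsingle : ∀ i t, E (Pi.single i t) = t * direction n i := fun i t => by
    simp only [E]
    rw [Finset.sum_eq_single i (fun j _ hj => by simp [hj]) (by simp), Pi.single_eq_same]
  have hmem : ∀ x ∈ Star n, E x ∈ simpleOdSet n := fun x hx => by
    rw [eq_single hx, hsingle]
    exact ⟨size x, legOf x, ⟨size_nonneg hx, size_le_one hx⟩, (legOf x).2, rfl⟩
  let g : Star n → simpleOdSet n := fun x => ⟨E x, hmem x x.2⟩
  have hg : Continuous g := (hE.comp continuous_subtype_val).subtype_mk _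
  have hbij : Function.Bijective g := by
    constructor
    · rintro ⟨x, hx⟩ ⟨y, hy⟩ h
      have h1 : E x = E y := congrArg Subtype.val h
      rw [eq_single hx, eq_single hy, hsingle, hsingle] at h1
      have h2 := congrArg norm h1
      rw [norm_mul, norm_mul, norm_direction, norm_direction, mul_one, mul_one,
        Complex.norm_of_nonneg (size_nonneg hx), Complex.norm_of_nonneg (size_nonneg hy)] at h2
      apply Subtype.ext
      change x = y
      rw [eq_single hx, eq_single hy, ← h2]
      rw [← h2] at h1
      by_cases h0 : size x = 0
      · rw [h0, Pi.single_zero, Pi.single_zero]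
      · have h3 := mul_left_cancel₀ (Complex.ofReal_ne_zero.2 h0) h1
        rw [Fin.ext (direction_injOn (legOf x).2 (legOf y).2 h3)]
    · rintro ⟨z, t, k, ht, hk, rfl⟩
      exact ⟨⟨_, single_mem_Star (i := ⟨k, hk⟩) ht.1 ht.2⟩, Subtype.ext (hsingle _ _)⟩
  exact ⟨Continuous.homeoOfEquivCompactToT2 (f := Equiv.ofBijective g hbij) hg⟩

section Like

variable {K : Type*} [MetricSpace K] [CompactSpace K] {W : ℕ} {π : ℕ → K → Star n}

theorem isLike_simpleOdSet (hW : 2 * n ^ 2 ≤ W) (hπ : IsLimit (starMap n W) π) :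
    IsLike K (simpleOdSet n) := by
  intro ε hε
  obtain ⟨N, δ, hδ, hN⟩ := hπ.exists_uniform continuous_id (half_pos hε)
  obtain ⟨e⟩ := exists_homeomorph_simpleOdSet (n := n)
  refine ⟨fun x => e (π N x), e.continuous.comp (hπ.continuous N),
    e.surjective.comp (hπ.surjective (surjective_starMap hW) N), fun y => ?_⟩
  refine (Metric.diam_le_of_forall_dist_le (half_pos hε).le fun x hx z hz => ?_).trans_lt
    (half_lt_self hε)
  have : π N x = π N z := e.injective ((mem_singleton_iff.1 hx).trans (mem_singleton_iff.1 hz).symm)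
  refine (hN x z ?_).le
  rwa [this, dist_self]

theorem IsLabel.descend {X : Type*} [MetricSpace X] [PreconnectedSpace X] [Nonempty X] {m : ℕ}
    {δ : ℝ} {h : X → Fin m → ℕ} (hh : IsLabel δ h) (hδ : 0 < δ) (hn : 3 ≤ n) (hm : 0 < m)
    (hmn : m < n) (hW : 72 * n ^ 2 < W) {g : X → Star n}
    (hg : ∀ x y, dist x y < δ → dist (g x) (g y) < 1 / (16 * W))
    (hfib : ∀ x y, h x = h y → dist (starMap n W (g x)) (starMap n W (g y)) < 1 / 8) :
    ∃ h' : X → Fin m → ℕ, IsLabel δ h' ∧ ∀ x y, h' x = h' y → dist (g x) (g y) < 1 / 8 := by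
  have hW0 : (0 : ℝ) < W := by exact_mod_cast (Nat.zero_le _).trans_lt hW
  obtain ⟨b, hb⟩ := hh.bounded
  have hg' : ∀ x y, dist x y < δ → dist (g x : Fin n → ℝ) (g y) < 1 / (16 * W) := hg
  let D : Labelling X n m :=
    { adj := fun u v => dist u v < δ
      adj_refl := fun u => by rwa [dist_self]
      adj_symm := fun u v huv => by rwa [dist_comm]
      chain := reflTransGen_dist_lt hδ
      θ := fun x => W * size (g x : Fin n → ℝ)
      leg := fun x => legOf (g x : Fin n → ℝ)
      h := h
      bound := b
      θ_nonneg := fun x => mul_nonneg hW0.le (size_nonneg (g x).2)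
      leg_lt := fun x => (legOf (g x : Fin n → ℝ)).2
      θ_step := fun x y hxy => by
        rw [← mul_sub, abs_mul, abs_of_pos hW0]
        have h1 := (abs_size_sub_le (g x).2 (g y).2).trans_lt (hg' x y hxy)
        rw [lt_div_iff₀ (by positivity)] at h1
        linarith
      leg_step := fun x y hxy hne => by
        obtain ⟨h1, h2⟩ := size_le_dist (g x).2 (g y).2 fun h => hne (congrArg Fin.val h)
        have h3 := h1.trans_lt (hg' x y hxy)
        have h4 := h2.trans_lt (hg' x y hxy)
        rw [lt_div_iff₀ (by positivity)] at h3 h4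
        constructor <;> linarith
      h_support := hh.support
      h_step := hh.step
      h_cross := hh.cross
      h_le := hb
      fiber := fun x y hxy hx => by
        have h1 : dist (fold n W (g x)) (fold n W (g y)) < 1 / 8 := hfib x y hxy
        rw [fold_eq (g x).2, fold_eq (g y).2] at h1
        set a := height n (legOf (g x : Fin n → ℝ)) ⌊W * size (g x : Fin n → ℝ)⌋₊ *
          bump (W * size (g x : Fin n → ℝ) - ⌊W * size (g x : Fin n → ℝ)⌋₊)
        set a' := height n (legOf (g y : Fin n → ℝ)) ⌊W * size (g y : Fin n → ℝ)⌋₊ *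
          bump (W * size (g y : Fin n → ℝ) - ⌊W * size (g y : Fin n → ℝ)⌋₊)
        set s := ⌊W * size (g x : Fin n → ℝ)⌋₊
        set s' := ⌊W * size (g y : Fin n → ℝ)⌋₊
        have h2 := (dist_le_pi_dist _ _ (Fin.ofNat n s)).trans_lt h1
        rw [Real.dist_eq, Pi.single_eq_same, abs_lt] at h2
        by_cases hs : Fin.ofNat n s = Fin.ofNat n s'
        · rw [hs, Pi.single_eq_same] at h2
          have := congrArg Fin.val hs
          exact ⟨this.symm, by linarith⟩
        · rw [Pi.single_eq_of_ne hs] at h2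
          linarith }
  obtain ⟨r, hr⟩ := D.exists_collapse hn hm hmn
  have hsmall : (9 * n ^ 2 : ℝ) / W < 1 / 8 := by
    have : (72 * n ^ 2 : ℝ) < W := by exact_mod_cast hW
    rw [div_lt_iff₀ hW0]; linarith
  refine ⟨fun x i => h x i - r i, ⟨fun x i j hi hj => hh.support x i j ?_ ?_,
    fun x y i hxy => ?_, fun x y i j hxy hi hj => hh.cross x y i j hxy ?_ ?_,
    b, fun x i => (Nat.sub_le _ _).trans (hb x i)⟩, fun x y hxy => lt_of_le_of_lt ?_ hsmall⟩
  · omega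
  · omega
  · have := hh.step x y i hxy
    omega
  · omega
  · omega
  · change dist (g x : Fin n → ℝ) (g y) ≤ _
    rcases hr x y fun i => congrFun hxy i with ⟨h1, h2⟩ | ⟨h1, h2⟩
    · have h3 : legOf (g x : Fin n → ℝ) = legOf (g y : Fin n → ℝ) := Fin.ext h1
      change |W * size (g x : Fin n → ℝ) - W * size (g y : Fin n → ℝ)| ≤ _ at h2
      rw [eq_single (g x).2, eq_single (g y).2, h3, dist_single, le_div_iff₀ hW0]
      rw [← mul_sub, abs_mul, abs_of_pos hW0] at h2
      linarith
    · change W * size (g x : Fin n → ℝ) ≤ _ at h1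
      change W * size (g y : Fin n → ℝ) ≤ _ at h2
      refine dist_le_of_size_le (g x).2 (g y).2 ?_ ?_ <;> rw [le_div_iff₀ hW0] <;> linarith

theorem exists_iterate_modulus {X : Type*} [MetricSpace X] [CompactSpace X] {f : X → X}
    (hf : Continuous f) {ε : ℝ} (hε : 0 < ε) (N : ℕ) :
    ∃ δ > 0, ∀ j < N, ∀ x y, dist x y < δ → dist (f^[j] x) (f^[j] y) < ε := by
  induction N with
  | zero => exact ⟨1, one_pos, fun j hj => (Nat.not_lt_zero j hj).elim⟩
  | succ N ih =>
    obtain ⟨δ, hδ, h⟩ := ih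
    obtain ⟨δ', hδ', h'⟩ := Metric.uniformContinuous_iff.1
      (CompactSpace.uniformContinuous_of_continuous (hf.iterate N)) ε hε
    refine ⟨min δ δ', lt_min hδ hδ', fun j hj x y hxy => ?_⟩
    rcases (Nat.lt_succ_iff.1 hj).lt_or_eq with hj | rfl
    · exact h j hj x y (hxy.trans_le (min_le_left _ _))
    · exact h' (hxy.trans_le (min_le_right _ _))

theorem exists_fiber_modulus {Y Z : Type*} [MetricSpace Y] [MetricSpace Z] {F : K → Y}
    {G : K → Z} (hF : Continuous F) (hG : Continuous G) {ε : ℝ}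
    (h : ∀ x y, F x = F y → dist (G x) (G y) < ε) :
    ∃ M : ℕ, 0 < M ∧ ∀ x y, dist (F x) (F y) < 1 / M → dist (G x) (G y) < ε := by
  have hQ : IsCompact {p : K × K | ε ≤ dist (G p.1) (G p.2)} :=
    (isClosed_le continuous_const ((hG.comp continuous_fst).dist (hG.comp continuous_snd))).isCompact
  rcases Set.eq_empty_or_nonempty {p : K × K | ε ≤ dist (G p.1) (G p.2)} with h0 | hne
  · refine ⟨1, one_pos, fun x y _ => ?_⟩
    by_contra hcon
    have : (x, y) ∈ {p : K × K | ε ≤ dist (G p.1) (G p.2)} := not_lt.1 hcon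
    rw [h0] at this
    exact this
  · obtain ⟨p, hp, hmin⟩ := hQ.exists_isMinOn hne
      ((hF.comp continuous_fst).dist (hF.comp continuous_snd)).continuousOn
    have hpos : 0 < dist (F p.1) (F p.2) := by
      refine dist_pos.2 fun heq => ?_
      have h1 : ε ≤ dist (G p.1) (G p.2) := hp
      linarith [h _ _ heq]
    obtain ⟨M, hM⟩ := exists_nat_one_div_lt hpos
    refine ⟨M + 1, M.succ_pos, fun x y hxy => ?_⟩
    by_contra hcon
    have h1 : dist (F p.1) (F p.2) ≤ dist (F x) (F y) := hmin (a := (x, y)) (not_lt.1 hcon)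
    push_cast at hxy
    linarith

theorem isLabel_floor {X : Type*} [MetricSpace X] {m M : ℕ} (hM : 0 < M) {δ : ℝ} {F : X → Star m}
    (hF : ∀ x y, dist x y < δ → dist (F x) (F y) < 1 / M) :
    IsLabel δ fun x i => ⌊M * (F x : Fin m → ℝ) i⌋₊ := by
  have hM0 : (0 : ℝ) < M := by exact_mod_cast hM
  have hne : ∀ x i, ⌊M * (F x : Fin m → ℝ) i⌋₊ ≠ 0 → 1 ≤ M * (F x : Fin m → ℝ) i :=
    fun x i h => Nat.floor_pos.1 (Nat.pos_of_ne_zero h)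
  have hlt : ∀ x y i, dist x y < δ → M * (F x : Fin m → ℝ) i < M * (F y : Fin m → ℝ) i + 1 := by
    intro x y i hxy
    have h1 : dist (F x : Fin m → ℝ) (F y) < 1 / M := hF x y hxy
    have h2 := (dist_le_pi_dist _ _ i).trans_lt h1
    rw [Real.dist_eq, abs_lt, lt_div_iff₀ hM0] at h2
    linarith
  refine ⟨fun x i j hi hj => ?_, fun x y i hxy => ?_, fun x y i j hxy hi hj => ?_, M, fun x i => ?_⟩
  · by_contra hij
    have h1 := hne x i hi
    have h2 := hne x j hj
    rcases (F x).2.2 i j hij with h | h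
    · rw [h] at h1; linarith
    · rw [h] at h2; linarith
  · have h0 : 0 ≤ M * (F y : Fin m → ℝ) i := mul_nonneg hM0.le ((F y).2.1 i).1
    rw [← Nat.floor_add_one h0]
    exact Nat.floor_le_floor (hlt x y i hxy).le
  · by_contra hij
    have h1 := hne x i hi
    have h2 := hne y j hj
    have h3 := hlt x y i hxy
    rcases (F y).2.2 i j hij with h | h
    · rw [h] at h3; linarith
    · rw [h] at h2; linarith
  · refine Nat.floor_le_of_le ?_
    have := ((F x).2.1 i).2
    nlinarith

theorem not_isLike_simpleOdSet {m : ℕ} (hn : 3 ≤ n) (hm : 0 < m) (hmn : m < n)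
    (hW : 72 * n ^ 2 < W) (hπ : IsLimit (starMap n W) π) : ¬ IsLike K (simpleOdSet m) := by
  intro hlike
  have : NeZero m := ⟨hm.ne'⟩
  have hW0 : (0 : ℝ) < W := by exact_mod_cast (Nat.zero_le _).trans_lt hW
  obtain ⟨ε, hε, hε'⟩ := Metric.uniformContinuous_iff.1
    (CompactSpace.uniformContinuous_of_continuous (hπ.continuous 0)) (1 / 8) (by norm_num)
  obtain ⟨g, hg, -, hdiam⟩ := hlike ε hε
  obtain ⟨e⟩ := exists_homeomorph_simpleOdSet (n := m)
  obtain ⟨M, hM, hM'⟩ := exists_fiber_modulus (F := fun x => e.symm (g x))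
    (e.symm.continuous.comp hg) (hπ.continuous 0) (ε := 1 / 8) fun x y hxy => hε' <|
      (Metric.dist_le_diam_of_mem (isCompact_univ.isBounded.subset (subset_univ _))
        (show x ∈ g ⁻¹' {g x} from rfl) (e.symm.injective hxy).symm).trans_lt (hdiam (g x))
  obtain ⟨N, δ, hδ, hN⟩ := hπ.exists_uniform (φ := fun x => e.symm (g x))
    (e.symm.continuous.comp hg) (ε := 1 / M) (by positivity)
  obtain ⟨δ', hδ', hiter⟩ := exists_iterate_modulus (continuous_starMap (n := n) W)
    (ε := 1 / (16 * W)) (by positivity) N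
  obtain ⟨σ, hσ⟩ := (hπ.surjective (surjective_starMap (by omega)) N).hasRightInverse
  have : Nonempty (Star n) := ⟨⟨0, zero_mem_Star⟩⟩
  have hmin : 0 < min δ δ' := lt_min hδ hδ'
  have key : ∀ d ≤ N, ∃ h : Star n → Fin m → ℕ, IsLabel (min δ δ') h ∧ ∀ x y, h x = h y →
      dist ((starMap n W)^[N - d] x) ((starMap n W)^[N - d] y) < 1 / 8 := by
    intro d
    induction d with
    | zero =>
      refine fun _ => ⟨_, isLabel_floor hM (F := fun x => e.symm (g (σ x))) fun x y hxy =>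
        hN _ _ (by rw [hσ, hσ]; exact hxy.trans_le (min_le_left _ _)), fun x y hxy => ?_⟩
      have h1 : ∀ x, (starMap n W)^[N] x = π 0 (σ x) := fun x => by
        have := hπ.iterate 0 N (σ x)
        rwa [zero_add, hσ] at this
      rw [Nat.sub_zero, h1, h1]
      have hM0 : (0 : ℝ) < M := by exact_mod_cast hM
      refine hM' _ _ ((dist_pi_lt_iff (by positivity)).2 fun i => ?_)
      have h2 := congrFun hxy i
      have h3 : ∀ z : Star m, 0 ≤ M * (z : Fin m → ℝ) i := fun z => mul_nonneg hM0.le (z.2.1 i).1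
      have h4 := Nat.floor_le (h3 (e.symm (g (σ x))))
      have h5 := Nat.floor_le (h3 (e.symm (g (σ y))))
      have h6 := Nat.lt_floor_add_one (M * (e.symm (g (σ x)) : Fin m → ℝ) i)
      have h7 := Nat.lt_floor_add_one (M * (e.symm (g (σ y)) : Fin m → ℝ) i)
      rw [h2] at h4 h6
      rw [Real.dist_eq, abs_sub_lt_iff, lt_div_iff₀ hM0, lt_div_iff₀ hM0]
      constructor <;> linarith
    | succ d ih =>
      intro hd
      obtain ⟨h, hh, hfib⟩ := ih (by omega)
      refine hh.descend hmin hn hm hmn hW (fun x y hxy =>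
        hiter _ (by omega) x y (hxy.trans_le (min_le_right _ _))) fun x y hxy => ?_
      rw [← Function.iterate_succ_apply' (starMap n W), ← Function.iterate_succ_apply' (starMap n W),
        show (N - (d + 1)).succ = N - d by omega]
      exact hfib x y hxy
  obtain ⟨h, hh, hfib⟩ := key N le_rfl
  rw [Nat.sub_self] at hfib
  exact hh.false_of_injective hmin hn hm hmn hfib

end Like

end StarContinuum

/-- For every integer `n ≥ 3` there are a continuum `K` and `p ∈ K`
such that `K` is simple-`n`-od-like but not simple-`(n-1)`-od-like, every proper
nondegenerate subcontinuum of `K` is an arc, and every proper nondegenerate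
subcontinuum containing `p` is an arc having `p` as an endpoint. -/
theorem statement7 (n : ℕ) (hn : 3 ≤ n) :
    ∃ (K : Type) (_ : MetricSpace K), CompactSpace K ∧ ConnectedSpace K ∧ Nonempty K ∧
      ∃ p : K,
        IsLike K (simpleOdSet n) ∧ ¬ IsLike K (simpleOdSet (n - 1)) ∧
        (∀ A : Set K, IsCompact A → IsConnected A → A ≠ Set.univ → A.Nontrivial →
          IsArcSet A) ∧
        (∀ A : Set K, IsCompact A → IsConnected A → A ≠ Set.univ → A.Nontrivial →
          p ∈ A → ∃ h : ↥(Set.Icc (0:ℝ) 1) ≃ₜ ↥A,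
            ((h ⟨0, Set.left_mem_Icc.mpr zero_le_one⟩ : ↥A) : K) = p) := by
  have : NeZero n := ⟨by omega⟩
  have hn2 : 0 < n ^ 2 := by positivity
  obtain ⟨K, _, π, _, _, hπ⟩ :=
    StarContinuum.exists_limit (StarContinuum.continuous_starMap (n := n) (2 * (100 * n ^ 2)))
  obtain ⟨p, hp⟩ := hπ.exists_of_thread (fun _ => ⟨0, StarContinuum.zero_mem_Star⟩)
    fun _ => Subtype.ext StarContinuum.fold_zero
  have hp0 : ∀ k, (π k p : Fin n → ℝ) = 0 := fun k => congrArg Subtype.val (hp k)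
  refine ⟨K, inferInstance, inferInstance, { toNonempty := ⟨p⟩ }, ⟨p⟩, p,
    StarContinuum.isLike_simpleOdSet (by omega) hπ,
    StarContinuum.not_isLike_simpleOdSet hn (by omega) (by omega) (by omega) hπ, ?_, ?_⟩
  · intro A hA hA' hne hnt
    obtain ⟨e, -⟩ := StarContinuum.exists_arc (by omega) hπ hA hA' hne hnt
    exact ⟨e.symm⟩
  · intro A hA hA' hne hnt hpA
    obtain ⟨e, he⟩ := StarContinuum.exists_arc (by omega) hπ hA hA' hne hnt
    exact ⟨e, he p hpA hp0⟩
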